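/- arXiv:1203.6547 — 13 statements merged into one kernel-verified Lean document; each statement's English description precedes it below -/
import Mathlib

section
/- For every p ≥ 0 the invariant density has finite p-th absolute moment: ∫_ℝ |y|^p f(y) dy < ∞. -/
open MeasureTheory

lemma half_aux (S : ℝ → ℝ) (hS : Continuous S) (A γ : ℝ) (hγ : 0 < γ)
    (hSr : ∀ x, A < x → S x ≤ -γ) (p : ℝ) (hp : 0 ≤ p) :
    IntegrableOn (fun x => |x| ^ p * Real.exp (2 * ∫ y in (0:ℝ)..x, S y)) (Set.Ioi 0) := by
  have hint : ∀ a b, IntervalIntegrable S volume a b := fun a b => hS.intervalIntegrable a b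
  have hc : Continuous (fun x => ∫ y in (0:ℝ)..x, S y) :=
    intervalIntegral.continuous_primitive hint 0
  refine integrable_of_isBigO_exp_neg (b := γ) hγ ?_ ?_
  · apply Continuous.continuousOn
    exact (continuous_abs.rpow_const (fun x => Or.inr hp)).mul
      (Real.continuous_exp.comp (continuous_const.mul hc))
  · have h1 := (isLittleO_rpow_exp_pos_mul_atTop p hγ).isBigO
    obtain ⟨C, hC⟩ := h1.bound
    refine Asymptotics.IsBigO.of_bound
      (C * Real.exp (2 * (∫ y in (0:ℝ)..A, S y) + 2 * γ * A)) ?_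
    filter_upwards [hC, Filter.eventually_gt_atTop A, Filter.eventually_gt_atTop 0]
      with x hx hxA hx0
    have h2 : ∫ y in A..x, S y ≤ ∫ y in A..x, -γ := by
      apply intervalIntegral.integral_mono_on_of_le_Ioo hxA.le (hint _ _) (by simp)
      intro y hy
      exact hSr y hy.1
    have h3 := intervalIntegral.integral_add_adjacent_intervals (hint 0 A) (hint A x)
    simp only [intervalIntegral.integral_const, smul_eq_mul] at h2
    rw [Real.norm_eq_abs, Real.norm_eq_abs, Real.abs_exp,
      abs_of_nonneg (by positivity : (0:ℝ) ≤ x ^ p)] at hx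
    rw [Real.norm_eq_abs, Real.norm_eq_abs, Real.abs_exp, abs_of_nonneg (by positivity),
      abs_of_pos hx0]
    have h4 : Real.exp (2 * ∫ y in (0:ℝ)..x, S y) ≤
        Real.exp ((2 * (∫ y in (0:ℝ)..A, S y) + 2 * γ * A) + (-2 * γ * x)) := by
      apply Real.exp_le_exp.2
      linarith
    calc _ ≤ (C * Real.exp (γ * x)) *
          Real.exp ((2 * (∫ y in (0:ℝ)..A, S y) + 2 * γ * A) + (-2 * γ * x)) :=
          mul_le_mul hx h4 (Real.exp_pos _).le (le_trans (by positivity) hx)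
      _ = _ := by
          rw [mul_assoc C, mul_assoc C, ← Real.exp_add, ← Real.exp_add]
          ring_nf

/-- For every `p ≥ 0` the invariant density has finite `p`-th absolute moment:
`∫ |y|^p f(y) dy < ∞`. -/
theorem stmt_2
    (S : ℝ → ℝ) (hS : Continuous S)
    (A γ : ℝ) (hA : 0 < A) (hγ : 0 < γ)
    (hSr : ∀ x, A < x → S x ≤ -γ)
    (hSl : ∀ x, x < -A → γ ≤ S x)
    (B : ℝ → ℝ) (hB : ∀ x, B x = 2 * ∫ y in (0:ℝ)..x, S y)
    (G : ℝ) (hG : G = ∫ y : ℝ, Real.exp (B y))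
    (f : ℝ → ℝ) (hf : ∀ x, f x = Real.exp (B x) / G) :
    ∀ p : ℝ, 0 ≤ p → Integrable (fun y => |y| ^ p * f y) := by
  intro p hp
  have h1 := half_aux S hS A γ hγ hSr p hp
  have h2 := half_aux (fun x => -S (-x)) (hS.comp continuous_neg).neg A γ hγ
    (fun x hx => neg_le_neg (hSl (-x) (neg_lt_neg hx))) p hp
  have h3 : IntegrableOn (fun x => |x| ^ p * Real.exp (2 * ∫ y in (0:ℝ)..x, S y))
      (Set.Iio 0) := by
    have h4 := h2.comp_neg
    simpa [intervalIntegral.integral_symm _ (0:ℝ)] using h4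
  have h5 : Integrable (fun x => |x| ^ p * Real.exp (2 * ∫ y in (0:ℝ)..x, S y)) := by
    rw [← integrableOn_univ, ← Set.Iic_union_Ioi (a := (0:ℝ))]
    exact ((integrableOn_Iic_iff_integrableOn_Iio (by finiteness)).2 h3).union h1
  refine (h5.div_const G).congr (Filter.Eventually.of_forall fun x => ?_)
  simp only [hf, hB, mul_div_assoc]
end

section
/- There exists a constant C > 0 such that f(x) ≤ C·exp(−2γ|x|) for all x with |x| > A. -/
open MeasureTheory

/-- There is `C > 0` with `f(x) ≤ C·exp(−2γ|x|)` for all `|x| > A`. -/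
theorem stmt_4
    (S : ℝ → ℝ) (hS : Continuous S)
    (A γ : ℝ) (hA : 0 < A) (hγ : 0 < γ)
    (hSr : ∀ x, A < x → S x ≤ -γ)
    (hSl : ∀ x, x < -A → γ ≤ S x)
    (B : ℝ → ℝ) (hB : ∀ x, B x = 2 * ∫ y in (0:ℝ)..x, S y)
    (G : ℝ) (hG : G = ∫ y : ℝ, Real.exp (B y))
    (f : ℝ → ℝ) (hf : ∀ x, f x = Real.exp (B x) / G) :
    ∃ C > (0:ℝ), ∀ x : ℝ, A < |x| → f x ≤ C * Real.exp (-2 * γ * |x|) := by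
  have hi : ∀ a b, IntervalIntegrable S volume a b := fun a b => hS.intervalIntegrable a b
  have hG0 : 0 ≤ G := by
    rw [hG]; exact integral_nonneg fun y => (Real.exp_pos _).le
  have key : ∀ x : ℝ, A < |x| → B x ≤ (|B A| + |B (-A)| + 2 * γ * A) + -2 * γ * |x| := by
    intro x hx
    have h1 := le_abs_self (B A)
    have h2 := le_abs_self (B (-A))
    have h3 := abs_nonneg (B A)
    have h4 := abs_nonneg (B (-A))
    rcases lt_abs.1 hx with h | h
    · rw [abs_of_pos (hA.trans h)]
      have e := intervalIntegral.integral_add_adjacent_intervals (hi 0 A) (hi A x)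
      have m : ∫ y in A..x, S y ≤ ∫ _y in A..x, -γ :=
        intervalIntegral.integral_mono_on_of_le_Ioo h.le (hi A x)
          (continuous_const.intervalIntegrable _ _) fun y hy => hSr y hy.1
      rw [intervalIntegral.integral_const, smul_eq_mul] at m
      have b1 := hB x
      have b2 := hB A
      linarith
    · rw [abs_of_neg (show x < 0 by linarith)]
      have e := intervalIntegral.integral_add_adjacent_intervals (hi 0 x) (hi x (-A))
      have m : ∫ _y in x..(-A), γ ≤ ∫ y in x..(-A), S y :=
        intervalIntegral.integral_mono_on_of_le_Ioo (by linarith)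
          (continuous_const.intervalIntegrable _ _) (hi x (-A)) fun y hy => hSl y hy.2
      rw [intervalIntegral.integral_const, smul_eq_mul] at m
      have b1 := hB x
      have b2 := hB (-A)
      linarith
  have hGi : 0 ≤ G⁻¹ := inv_nonneg.2 hG0
  refine ⟨Real.exp (|B A| + |B (-A)| + 2 * γ * A) * G⁻¹ + 1, by positivity, fun x hx => ?_⟩
  have h := Real.exp_le_exp.2 (key x hx)
  rw [Real.exp_add] at h
  have h' := mul_le_mul_of_nonneg_right h hGi
  have hp := Real.exp_pos (-2 * γ * |x|)
  rw [hf, div_eq_mul_inv]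
  linarith
end

section
/- There exists a constant C > 0 such that 1 − F(x) ≤ C·exp(−2γx) for all x > A, and F(x) ≤ C·exp(2γx) for all x < −A. -/
open MeasureTheory

/-- There is `C > 0` with `1 − F(x) ≤ C·exp(−2γx)` for `x > A` and
`F(x) ≤ C·exp(2γx)` for `x < −A`. -/
theorem stmt_5
    (S : ℝ → ℝ) (hS : Continuous S)
    (A γ : ℝ) (hA : 0 < A) (hγ : 0 < γ)
    (hSr : ∀ x, A < x → S x ≤ -γ)
    (hSl : ∀ x, x < -A → γ ≤ S x)
    (B : ℝ → ℝ) (hB : ∀ x, B x = 2 * ∫ y in (0:ℝ)..x, S y)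
    (G : ℝ) (hG : G = ∫ y : ℝ, Real.exp (B y))
    (f : ℝ → ℝ) (hf : ∀ x, f x = Real.exp (B x) / G)
    (F : ℝ → ℝ) (hF : ∀ x, F x = ∫ y in Set.Iic x, f y) :
    ∃ C > (0:ℝ),
      (∀ x, A < x → 1 - F x ≤ C * Real.exp (-2 * γ * x)) ∧
      (∀ x, x < -A → F x ≤ C * Real.exp (2 * γ * x)) := by
  have hii : ∀ a b, IntervalIntegrable S volume a b := fun a b => hS.intervalIntegrable a b
  have hBc : Continuous B := by
    have : B = fun x => 2 * ∫ y in (0:ℝ)..x, S y := funext hB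
    rw [this]
    exact continuous_const.mul (intervalIntegral.continuous_primitive hii 0)
  have hdiff : ∀ a b, B b - B a = 2 * ∫ y in a..b, S y := by
    intro a b
    rw [hB, hB, ← intervalIntegral.integral_interval_sub_left (hii 0 b) (hii 0 a)]
    ring
  have hr : ∀ y, A < y → Real.exp (B y) ≤ Real.exp (B A + 2 * γ * A) * Real.exp (-2 * γ * y) := by
    intro y hy
    rw [← Real.exp_add]
    apply Real.exp_le_exp.mpr
    have h1 := intervalIntegral.integral_mono_on_of_le_Ioo hy.le (hii A y)
      (intervalIntegrable_const (c := -γ)) (fun z hz => hSr z hz.1)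
    have h2 := hdiff A y
    simp only [intervalIntegral.integral_const, smul_eq_mul] at h1
    nlinarith
  have hl : ∀ y, y < -A →
      Real.exp (B y) ≤ Real.exp (B (-A) + 2 * γ * A) * Real.exp (2 * γ * y) := by
    intro y hy
    rw [← Real.exp_add]
    apply Real.exp_le_exp.mpr
    have h1 := intervalIntegral.integral_mono_on_of_le_Ioo hy.le
      (intervalIntegrable_const (c := γ)) (hii y (-A)) (fun z hz => hSl z hz.2)
    have h2 := hdiff y (-A)
    simp only [intervalIntegral.integral_const, smul_eq_mul] at h1
    nlinarith
  have hEc : Continuous fun y => Real.exp (B y) := Real.continuous_exp.comp hBc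
  set K := Real.exp (B A + 2 * γ * A) with hK
  set L := Real.exp (B (-A) + 2 * γ * A) with hL
  have hK0 : 0 < K := Real.exp_pos _
  have hL0 : 0 < L := Real.exp_pos _
  have hn : -2 * γ < 0 := by linarith
  have hp : 0 < 2 * γ := by linarith
  have hir : ∀ x, IntegrableOn (fun y => K * Real.exp (-2 * γ * y)) (Set.Ioi x) := fun x =>
    (integrableOn_exp_mul_Ioi hn x).const_mul K
  have hil : ∀ x, IntegrableOn (fun y => L * Real.exp (2 * γ * y)) (Set.Iic x) := fun x =>
    (integrableOn_exp_mul_Iic hp x).const_mul L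
  have hI1 : IntegrableOn (fun y => Real.exp (B y)) (Set.Ioi A) := by
    refine (hir A).mono' hEc.aestronglyMeasurable ?_
    filter_upwards [ae_restrict_mem measurableSet_Ioi] with y hy
    rw [Real.norm_eq_abs, Real.abs_exp]
    exact hr y hy
  have hI2 : IntegrableOn (fun y => Real.exp (B y)) (Set.Iio (-A)) := by
    refine ((hil (-A)).mono_set Set.Iio_subset_Iic_self).mono' hEc.aestronglyMeasurable ?_
    filter_upwards [ae_restrict_mem measurableSet_Iio] with y hy
    rw [Real.norm_eq_abs, Real.abs_exp]
    exact hl y hy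
  have hI3 : IntegrableOn (fun y => Real.exp (B y)) (Set.Icc (-A) A) :=
    hEc.continuousOn.integrableOn_Icc
  have hI : Integrable (fun y => Real.exp (B y)) := by
    rw [← integrableOn_univ]
    refine ((hI2.union hI3).union hI1).mono_set ?_
    intro y _
    by_cases h1 : y < -A
    · exact Or.inl (Or.inl h1)
    · by_cases h2 : A < y
      · exact Or.inr h2
      · exact Or.inl (Or.inr ⟨not_lt.mp h1, not_lt.mp h2⟩)
  have hG0 : 0 < G := by
    rw [hG]
    exact integral_exp_pos hI
  have hFx : ∀ x, F x = (∫ y in Set.Iic x, Real.exp (B y)) / G := by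
    intro x
    rw [hF, ← integral_div]
    simp only [hf]
  have hsum : ∀ x, 1 - F x = (∫ y in Set.Ioi x, Real.exp (B y)) / G := by
    intro x
    have h := intervalIntegral.integral_Iic_add_Ioi (b := x) hI.integrableOn hI.integrableOn
    rw [← hG] at h
    rw [hFx]
    field_simp
    linarith
  refine ⟨(K + L) / (2 * γ * G), by positivity, ?_, ?_⟩
  · intro x hx
    rw [hsum]
    have h := setIntegral_mono_on hI.integrableOn (hir x) measurableSet_Ioi
      (fun y hy => hr y (hx.trans hy))
    rw [integral_const_mul, integral_exp_mul_Ioi hn] at h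
    have he := Real.exp_pos (-2 * γ * x)
    calc _ ≤ (K * (-Real.exp (-2 * γ * x) / (-2 * γ))) / G := by gcongr
      _ = K / (2 * γ * G) * Real.exp (-2 * γ * x) := by field_simp
      _ ≤ _ := by gcongr; linarith
  · intro x hx
    rw [hFx]
    have h := setIntegral_mono_on hI.integrableOn (hil x) measurableSet_Iic
      (fun y hy => hl y (lt_of_le_of_lt hy hx))
    rw [integral_const_mul, integral_exp_mul_Iic hp] at h
    have he := Real.exp_pos (2 * γ * x)
    calc _ ≤ (L * (Real.exp (2 * γ * x) / (2 * γ))) / G := by gcongr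
      _ = L / (2 * γ * G) * Real.exp (2 * γ * x) := by field_simp
      _ ≤ _ := by gcongr; linarith
end

section
/- There exists a constant C > 0 such that (1 − F(x))/f(x) ≤ C for all x ≥ A, and F(x)/f(x) ≤ C for all x ≤ −A. -/
open MeasureTheory

/-- There is `C > 0` with `(1 − F(x))/f(x) ≤ C` for all `x ≥ A` and
`F(x)/f(x) ≤ C` for all `x ≤ −A`. -/
theorem stmt_6
    (S : ℝ → ℝ) (hS : Continuous S)
    (A γ : ℝ) (hA : 0 < A) (hγ : 0 < γ)
    (hSr : ∀ x, A < x → S x ≤ -γ)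
    (hSl : ∀ x, x < -A → γ ≤ S x)
    (B : ℝ → ℝ) (hB : ∀ x, B x = 2 * ∫ y in (0:ℝ)..x, S y)
    (G : ℝ) (hG : G = ∫ y : ℝ, Real.exp (B y))
    (f : ℝ → ℝ) (hf : ∀ x, f x = Real.exp (B x) / G)
    (F : ℝ → ℝ) (hF : ∀ x, F x = ∫ y in Set.Iic x, f y) :
    ∃ C > (0:ℝ),
      (∀ x, A ≤ x → (1 - F x) / f x ≤ C) ∧
      (∀ x, x ≤ -A → F x / f x ≤ C) := by
  have hi : ∀ a b : ℝ, IntervalIntegrable S volume a b := fun a b => hS.intervalIntegrable a b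
  have hdiff : ∀ x y, B y - B x = 2 * ∫ t in x..y, S t := by
    intro x y
    rw [hB, hB, ← mul_sub, intervalIntegral.integral_interval_sub_left (hi _ _) (hi _ _)]
  have hBc : Continuous B := by
    have : B = fun x => 2 * ∫ y in (0:ℝ)..x, S y := funext hB
    rw [this]
    exact continuous_const.mul (intervalIntegral.continuous_primitive hi 0)
  have hEc : Continuous (fun y => Real.exp (B y)) := Real.continuous_exp.comp hBc
  have hr : ∀ x y, A ≤ x → x ≤ y → B y ≤ B x + -(2 * γ) * (y - x) := by
    intro x y hx hxy
    have h1 : ∫ t in x..y, S t ≤ ∫ t in x..y, (-γ) := by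
      apply intervalIntegral.integral_mono_on_of_le_Ioo hxy (hi _ _) (by simp)
      intro t ht
      exact hSr t (lt_of_le_of_lt hx ht.1)
    rw [intervalIntegral.integral_const, smul_eq_mul] at h1
    have := hdiff x y
    nlinarith
  have hl : ∀ x y, x ≤ -A → y ≤ x → B y ≤ B x + (2 * γ) * (y - x) := by
    intro x y hx hxy
    have h1 : ∫ t in y..x, γ ≤ ∫ t in y..x, S t := by
      apply intervalIntegral.integral_mono_on_of_le_Ioo hxy (by simp) (hi _ _)
      intro t ht
      exact hSl t (lt_of_lt_of_le ht.2 hx)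
    rw [intervalIntegral.integral_const, smul_eq_mul] at h1
    have := hdiff y x
    nlinarith
  have h2 : 0 < 2 * γ := by linarith
  have hbr : ∀ x, A ≤ x → ∀ y ∈ Set.Ioi x,
      Real.exp (B y) ≤ Real.exp (B x + 2 * γ * x) * Real.exp (-(2 * γ) * y) := by
    intro x hx y hy
    rw [← Real.exp_add, Real.exp_le_exp]
    linarith [hr x y hx (le_of_lt hy)]
  have hbl : ∀ x, x ≤ -A → ∀ y ∈ Set.Iic x,
      Real.exp (B y) ≤ Real.exp (B x - 2 * γ * x) * Real.exp (2 * γ * y) := by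
    intro x hx y hy
    rw [← Real.exp_add, Real.exp_le_exp]
    linarith [hl x y hx hy]
  have gr : ∀ x, IntegrableOn
      (fun y => Real.exp (B x + 2 * γ * x) * Real.exp (-(2 * γ) * y)) (Set.Ioi x) := fun x =>
    (integrableOn_exp_mul_Ioi (by linarith) x).const_mul _
  have gl : ∀ x, IntegrableOn
      (fun y => Real.exp (B x - 2 * γ * x) * Real.exp (2 * γ * y)) (Set.Iic x) := fun x =>
    (integrableOn_exp_mul_Iic h2 x).const_mul _
  have ir : ∀ x, A ≤ x → IntegrableOn (fun y => Real.exp (B y)) (Set.Ioi x) := by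
    intro x hx
    refine Integrable.mono' (gr x) hEc.aestronglyMeasurable ?_
    refine (ae_restrict_iff' measurableSet_Ioi).2 (Filter.Eventually.of_forall ?_)
    intro y hy
    rw [Real.norm_eq_abs, Real.abs_exp]
    exact hbr x hx y hy
  have il : ∀ x, x ≤ -A → IntegrableOn (fun y => Real.exp (B y)) (Set.Iic x) := by
    intro x hx
    refine Integrable.mono' (gl x) hEc.aestronglyMeasurable ?_
    refine (ae_restrict_iff' measurableSet_Iic).2 (Filter.Eventually.of_forall ?_)
    intro y hy
    rw [Real.norm_eq_abs, Real.abs_exp]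
    exact hbl x hx y hy
  have iE : Integrable (fun y => Real.exp (B y)) := by
    rw [← integrableOn_univ]
    have h := ((il (-A) le_rfl).union (hEc.integrableOn_Icc (a := -A) (b := A))).union (ir A le_rfl)
    refine h.mono_set ?_
    intro y _
    simp only [Set.mem_union, Set.mem_Iic, Set.mem_Icc, Set.mem_Ioi]
    by_cases h1 : y ≤ -A
    · exact Or.inl (Or.inl h1)
    · by_cases h3 : y ≤ A
      · exact Or.inl (Or.inr ⟨by linarith, h3⟩)
      · exact Or.inr (by linarith)
  have hGpos : 0 < G := by
    rw [hG]
    exact integral_exp_pos iE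
  have hF' : ∀ x, F x = (∫ y in Set.Iic x, Real.exp (B y)) / G := by
    intro x
    rw [hF]
    simp_rw [hf]
    rw [integral_div]
  have hsplit : ∀ x, (∫ y in Set.Iic x, Real.exp (B y)) + ∫ y in Set.Ioi x, Real.exp (B y) = G := by
    intro x
    rw [hG]
    exact intervalIntegral.integral_Iic_add_Ioi iE.integrableOn iE.integrableOn
  refine ⟨1 / (2 * γ), by positivity, ?_, ?_⟩
  · intro x hx
    have h1 : 1 - F x = (∫ y in Set.Ioi x, Real.exp (B y)) / G := by
      rw [hF', eq_div_iff hGpos.ne', sub_mul, div_mul_cancel₀ _ hGpos.ne']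
      linarith [hsplit x]
    rw [h1, hf, div_div_div_cancel_right₀ hGpos.ne', div_le_iff₀ (Real.exp_pos _)]
    refine (setIntegral_mono_on (ir x hx) (gr x) measurableSet_Ioi (hbr x hx)).trans ?_
    rw [integral_const_mul, integral_exp_mul_Ioi (by linarith), Real.exp_add]
    have : Real.exp (2 * γ * x) * Real.exp (-(2 * γ) * x) = 1 := by
      rw [← Real.exp_add]; simp
    apply le_of_eq
    rw [neg_div_neg_eq, mul_assoc, mul_div_assoc', this]
    ring
  · intro x hx
    rw [hF', hf, div_div_div_cancel_right₀ hGpos.ne', div_le_iff₀ (Real.exp_pos _)]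
    refine (setIntegral_mono_on (il x hx) (gl x) measurableSet_Iic (hbl x hx)).trans ?_
    rw [integral_const_mul, integral_exp_mul_Iic h2, mul_div_assoc', ← Real.exp_add]
    apply le_of_eq
    rw [sub_add_cancel]
    ring
end

section
/- If in addition S is continuously differentiable and its derivative has polynomial growth, i.e. |S'(x)| ≤ c(1 + |x|^p) for some constants c > 0 and p > 0, then the Fisher information I = ∫_ℝ S'(x)² f(x) dx is finite. -/
open MeasureTheory

lemma stmt_8_aux (S B h : ℝ → ℝ) (A γ c p : ℝ) (hγ : 0 < γ)
    (hSr : ∀ x, A < x → S x ≤ -γ)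
    (hB : ∀ x, HasDerivAt B (2 * S x) x) (hh : Continuous h)
    (hgrowth : ∀ x, |h x| ≤ c * (1 + |x| ^ p)) :
    IntegrableOn (fun x => (h x) ^ 2 * Real.exp (B x)) (Set.Ioi 0) := by
  have hBc : Continuous B := continuous_iff_continuousAt.2 fun x => (hB x).continuousAt
  have hd : ∀ x, HasDerivAt (fun x => B x + 2 * γ * x) (2 * S x + 2 * γ) x := by
    intro x
    have := (hB x).add ((hasDerivAt_id x).const_mul (2 * γ))
    refine HasDerivAt.congr_deriv (f := fun x => B x + 2 * γ * x) this ?_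
    ring
  have hanti : AntitoneOn (fun x => B x + 2 * γ * x) (Set.Ici A) := by
    apply antitoneOn_of_deriv_nonpos (convex_Ici A)
    · fun_prop
    · exact fun x _ => (hd x).differentiableAt.differentiableWithinAt
    · intro x hx
      rw [interior_Ici] at hx
      rw [(hd x).deriv]
      linarith [hSr x hx]
  have hExp : (fun x => Real.exp (B x)) =O[Filter.atTop] fun x => Real.exp (-(2 * γ) * x) := by
    apply Asymptotics.IsBigO.of_bound (Real.exp (B A + 2 * γ * A))
    filter_upwards [Filter.eventually_ge_atTop A] with x hx
    rw [Real.norm_eq_abs, Real.norm_eq_abs, Real.abs_exp, Real.abs_exp, ← Real.exp_add,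
      Real.exp_le_exp]
    have := hanti (Set.self_mem_Ici) hx hx
    simp only at this
    linarith
  have hpow : (fun x : ℝ => 1 + x ^ p) =O[Filter.atTop] fun x => Real.exp (γ / 2 * x) := by
    have h1 := (isLittleO_rpow_exp_pos_mul_atTop p (half_pos hγ)).isBigO
    have h0 := (isLittleO_rpow_exp_pos_mul_atTop 0 (half_pos hγ)).isBigO
    simp only [Real.rpow_zero] at h0
    exact h0.add h1
  have hhO : h =O[Filter.atTop] fun x => Real.exp (γ / 2 * x) := by
    refine Asymptotics.IsBigO.trans ?_ hpow
    apply Asymptotics.IsBigO.of_bound c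
    filter_upwards [Filter.eventually_ge_atTop 0] with x hx
    have h1 := hgrowth x
    rw [abs_of_nonneg hx] at h1
    rw [Real.norm_eq_abs, Real.norm_eq_abs, abs_of_nonneg (a := 1 + x ^ p) (by positivity)]
    exact h1
  apply integrable_of_isBigO_exp_neg hγ
  · fun_prop
  · refine ((hhO.pow 2).mul hExp).congr_right ?_
    intro x
    rw [← Real.exp_nat_mul, ← Real.exp_add]
    congr 1
    push_cast
    ring

/-- If in addition `S` is continuously differentiable and its derivative has
polynomial growth, `|S'(x)| ≤ c(1 + |x|^p)` for some `c > 0`, `p > 0`, then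
the Fisher information `I = ∫ S'(x)² f(x) dx` is finite. -/
theorem stmt_8
    (S : ℝ → ℝ) (hS : Continuous S)
    (A γ : ℝ) (hA : 0 < A) (hγ : 0 < γ)
    (hSr : ∀ x, A < x → S x ≤ -γ)
    (hSl : ∀ x, x < -A → γ ≤ S x)
    (B : ℝ → ℝ) (hB : ∀ x, B x = 2 * ∫ y in (0:ℝ)..x, S y)
    (G : ℝ) (hG : G = ∫ y : ℝ, Real.exp (B y))
    (f : ℝ → ℝ) (hf : ∀ x, f x = Real.exp (B x) / G)
    (S' : ℝ → ℝ) (hS' : ∀ x, HasDerivAt S (S' x) x) (hS'c : Continuous S')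
    (c p : ℝ) (hc : 0 < c) (hp : 0 < p)
    (hgrowth : ∀ x, |S' x| ≤ c * (1 + |x| ^ p)) :
    Integrable (fun x => (S' x) ^ 2 * f x) := by
  have hBd : ∀ x, HasDerivAt B (2 * S x) x := by
    intro x
    rw [show B = fun x => 2 * ∫ y in (0:ℝ)..x, S y from funext hB]
    exact (intervalIntegral.integral_hasDerivAt_right (hS.intervalIntegrable _ _)
      hS.stronglyMeasurable.stronglyMeasurableAtFilter hS.continuousAt).const_mul 2
  have hR := stmt_8_aux S B S' A γ c p hγ hSr hBd hS'c hgrowth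
  have hL := stmt_8_aux (fun x => -S (-x)) (fun x => B (-x)) (fun x => S' (-x)) A γ c p hγ
    (fun x hx => by linarith [hSl (-x) (by linarith)])
    (fun x => by
      have := (hBd (-x)).comp x (hasDerivAt_neg x)
      refine this.congr_deriv ?_
      ring)
    (by fun_prop) (fun x => by simpa using hgrowth (-x))
  have hL' : IntegrableOn (fun x => (S' x) ^ 2 * Real.exp (B x)) (Set.Iic 0) := by
    have h1 := (integrableOn_Ici_iff_integrableOn_Ioi).2 hL
    rw [← neg_zero] at h1
    have h2 := IntegrableOn.comp_neg_Iic h1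
    simpa using h2
  have hI : Integrable (fun x => (S' x) ^ 2 * Real.exp (B x)) := by
    rw [← integrableOn_univ, ← Set.Iic_union_Ioi (a := (0:ℝ))]
    exact hL'.union hR
  refine (hI.div_const G).congr (Filter.Eventually.of_forall fun x => ?_)
  simp only [hf]
  ring
end

section
/- The double integral ∫_ℝ [ ∫_ℝ ( ∫_0^z M(y,x) dy )² f(z) dz ] dx is finite, where the inner integral ∫_0^z is the signed integral from 0 to z. -/
open MeasureTheory

/-- One-sided decay estimate. -/
theorem aux_decay (g s : ℝ → ℝ) (hg : ∀ x, HasDerivAt g (s x) x) (A c : ℝ)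
    (hs : ∀ x, A < x → s x ≤ -c) :
    ∃ K : ℝ, 0 ≤ K ∧ ∀ y x, 0 ≤ y → y ≤ x → g x ≤ g y - c * (x - y) + K := by
  set h : ℝ → ℝ := fun x => g x + c * x with hh
  have hd : ∀ x, HasDerivAt h (s x + c) x := fun x => by
    simpa using! (hg x).add ((hasDerivAt_id x).const_mul c)
  have hcont : Continuous h := continuous_iff_continuousAt.2 fun x => (hd x).continuousAt
  obtain ⟨K, hK⟩ := (isCompact_Icc (a := (0:ℝ)) (b := A)).exists_bound_of_continuousOn
    hcont.continuousOn
  have hanti : AntitoneOn h (Set.Ici A) := by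
    apply antitoneOn_of_deriv_nonpos (convex_Ici A) hcont.continuousOn
    · exact fun x _ => (hd x).differentiableAt.differentiableWithinAt
    · intro x hx
      rw [interior_Ici] at hx
      rw [(hd x).deriv]
      linarith [hs x hx]
  refine ⟨2 * |K|, by positivity, fun y x hy hyx => ?_⟩
  have key : h x ≤ h y + 2 * |K| := by
    have hKK := le_abs_self K
    have hK0 := abs_nonneg K
    rcases le_total x A with hxA | hxA
    · have h1 := abs_le.1 (hK x ⟨hy.trans hyx, hxA⟩)
      have h2 := abs_le.1 (hK y ⟨hy, hyx.trans hxA⟩)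
      linarith [h1.2, h2.1]
    · rcases le_total y A with hyA | hyA
      · have h0 := hanti (Set.mem_Ici.2 le_rfl) (Set.mem_Ici.2 hxA) hxA
        have h1 := abs_le.1 (hK A ⟨hy.trans hyA, le_rfl⟩)
        have h2 := abs_le.1 (hK y ⟨hy, hyA⟩)
        linarith [h1.2, h2.1]
      · have h0 := hanti (Set.mem_Ici.2 hyA) (Set.mem_Ici.2 hxA) hyx
        linarith
  simp only [hh] at key
  linarith

theorem aux_int_exp (c : ℝ) (hc : 0 < c) : Integrable (fun x : ℝ => Real.exp (-c * |x|)) := by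
  rw [← integrableOn_univ, ← Set.Iic_union_Ioi (a := (0:ℝ)), integrableOn_union]
  constructor
  · refine (integrableOn_exp_mul_Iic hc 0).congr_fun (fun x hx => ?_) measurableSet_Iic
    simp only [abs_of_nonpos (Set.mem_Iic.1 hx)]
    ring_nf
  · refine (integrableOn_exp_mul_Ioi (neg_lt_zero.2 hc) 0).congr_fun (fun x hx => ?_)
      measurableSet_Ioi
    simp only [abs_of_pos (Set.mem_Ioi.1 hx)]

theorem aux_tail (f : ℝ → ℝ) (hfi : Integrable f) (D c y : ℝ) (hc : 0 < c)
    (h : ∀ x, y ≤ x → f x ≤ D * f y * Real.exp (-c * (x - y))) :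
    ∫ x in Set.Ioi y, f x ≤ D * f y / c := by
  have hi : IntegrableOn (fun x => D * f y * Real.exp (c * y) * Real.exp (-c * x)) (Set.Ioi y) :=
    (integrableOn_exp_mul_Ioi (neg_lt_zero.2 hc) y).const_mul _
  calc ∫ x in Set.Ioi y, f x
      ≤ ∫ x in Set.Ioi y, D * f y * Real.exp (c * y) * Real.exp (-c * x) := by
        refine setIntegral_mono_on hfi.integrableOn hi measurableSet_Ioi fun x hx => ?_
        refine (h x (le_of_lt hx)).trans (le_of_eq ?_)
        rw [mul_assoc (D * f y), ← Real.exp_add]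
        ring_nf
    _ = D * f y / c := by
        rw [integral_const_mul, integral_exp_mul_Ioi (neg_lt_zero.2 hc)]
        have : Real.exp (c * y) * Real.exp (-c * y) = 1 := by
          rw [← Real.exp_add]; simp
        calc _ = D * f y * (Real.exp (c * y) * Real.exp (-c * y)) / c := by
              field_simp
          _ = _ := by rw [this, mul_one]

theorem aux_core (f F : ℝ → ℝ) (M : ℝ → ℝ → ℝ) (hfc : Continuous f) (hfp : ∀ x, 0 < f x)
    (hfi : Integrable f) (hf1 : ∫ x, f x = 1) (γ D : ℝ) (hγ : 0 < γ) (hD : 0 < D)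
    (hR : ∀ y x, 0 ≤ y → y ≤ x → f x ≤ D * f y * Real.exp (-(2 * γ) * (x - y)))
    (hL : ∀ y x, y ≤ 0 → x ≤ y → f x ≤ D * f y * Real.exp (-(2 * γ) * (y - x)))
    (hF : ∀ x, F x = ∫ y in Set.Iic x, f y)
    (hM : ∀ y x, M y x = 2 * f x * ((if x < y then (1:ℝ) else 0) - F y) / f y) :
    Integrable (fun x => ∫ z : ℝ, (∫ y in (0:ℝ)..z, M y x) ^ 2 * f z) := by
  have h2γ : 0 < 2 * γ := by positivity
  have hE : ∀ x, f x ≤ D * f 0 * Real.exp (-(2 * γ) * |x|) := by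
    intro x
    rcases le_total 0 x with hx | hx
    · simpa [abs_of_nonneg hx] using hR 0 x le_rfl hx
    · simpa [abs_of_nonpos hx] using hL 0 x le_rfl hx
  have hsum : ∀ y, F y + ∫ x in Set.Ioi y, f x = 1 := by
    intro y
    rw [hF, ← hf1]
    exact intervalIntegral.integral_Iic_add_Ioi hfi.integrableOn hfi.integrableOn
  have hTR0 : ∀ y, 0 ≤ ∫ x in Set.Ioi y, f x := fun y =>
    integral_nonneg fun x => (hfp x).le
  have hF0 : ∀ y, 0 ≤ F y := fun y => by
    rw [hF]; exact integral_nonneg fun x => (hfp x).le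
  have hFle : ∀ y, F y ≤ 1 := fun y => by linarith [hsum y, hTR0 y]
  have hTR : ∀ y, 0 ≤ y → 1 - F y ≤ D / (2 * γ) * f y := by
    intro y hy
    have := aux_tail f hfi D (2 * γ) y h2γ (fun x hx => hR y x hy hx)
    have h3 := hsum y
    have : D * f y / (2 * γ) = D / (2 * γ) * f y := by ring
    linarith
  have hTL : ∀ y, y ≤ 0 → F y ≤ D / (2 * γ) * f y := by
    intro y hy
    have h1 := aux_tail (fun x => f (-x)) hfi.comp_neg D (2 * γ) (-y) h2γ (fun x hx => by
      have := hL y (-x) hy (by linarith)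
      simp only [neg_neg]
      refine this.trans (le_of_eq ?_)
      ring_nf)
    rw [integral_comp_neg_Ioi (f := f)] at h1
    simp only [neg_neg] at h1
    rw [← hF] at h1
    have : D * f y / (2 * γ) = D / (2 * γ) * f y := by ring
    linarith
  set E : ℝ := D + D * f 0 * (D / (2 * γ)) with hEdef
  have hf0 := hfp 0
  have hE0 : 0 < E := by positivity
  have hDE : D ≤ E := by
    have : 0 < D * f 0 * (D / (2 * γ)) := by positivity
    linarith
  have hDE' : D * f 0 * (D / (2 * γ)) ≤ E := by linarith
  -- two kinds of bounds
  have b1 : ∀ x y, f x * (D / (2 * γ)) ≤ E * Real.exp (γ / 2 * (|y| - |x|)) := by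
    intro x y
    calc f x * (D / (2 * γ)) ≤ (D * f 0 * Real.exp (-(2 * γ) * |x|)) * (D / (2 * γ)) := by
          gcongr; exact hE x
      _ = (D * f 0 * (D / (2 * γ))) * Real.exp (-(2 * γ) * |x|) := by ring
      _ ≤ E * Real.exp (γ / 2 * (|y| - |x|)) := by
          have hexp : Real.exp (-(2 * γ) * |x|) ≤ Real.exp (γ / 2 * (|y| - |x|)) :=
            Real.exp_le_exp.2 (by
              nlinarith [mul_nonneg hγ.le (abs_nonneg x), mul_nonneg hγ.le (abs_nonneg y)])
          exact mul_le_mul hDE' hexp (Real.exp_pos _).le hE0.le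
  have b2 : ∀ x y t, 0 ≤ t → t = |x| - |y| → f x ≤ D * f y * Real.exp (-(2 * γ) * t) →
      f x / f y ≤ E * Real.exp (γ / 2 * (|y| - |x|)) := by
    intro x y t ht htt h
    rw [div_le_iff₀ (hfp y)]
    have hy := hfp y
    calc f x ≤ D * f y * Real.exp (-(2 * γ) * t) := h
      _ ≤ E * f y * Real.exp (γ / 2 * (|y| - |x|)) := by
          have hexp : Real.exp (-(2 * γ) * t) ≤ Real.exp (γ / 2 * (|y| - |x|)) :=
            Real.exp_le_exp.2 (by
              have : |y| - |x| = -t := by linarith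
              rw [this]
              nlinarith [mul_nonneg hγ.le ht])
          exact mul_le_mul (mul_le_mul_of_nonneg_right hDE hy.le) hexp (Real.exp_pos _).le
            (by positivity)
      _ = _ := by ring
  have hMb : ∀ y x, |M y x| ≤ 2 * E * Real.exp (γ / 2 * (|y| - |x|)) := by
    intro y x
    have hy := hfp y
    have hx := hfp x
    rw [hM, abs_div, abs_mul, abs_of_pos hy, abs_of_pos (by positivity : 0 < 2 * f x)]
    -- the tail case
    have tail : ∀ w, w ≤ D / (2 * γ) * f y →
        2 * f x * w / f y ≤ 2 * E * Real.exp (γ / 2 * (|y| - |x|)) := by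
      intro w hw
      calc 2 * f x * w / f y ≤ 2 * f x * (D / (2 * γ) * f y) / f y := by gcongr
        _ = 2 * (f x * (D / (2 * γ))) := by field_simp
        _ ≤ 2 * (E * Real.exp (γ / 2 * (|y| - |x|))) := mul_le_mul_of_nonneg_left (b1 x y) zero_le_two
        _ = _ := by ring
    have near : ∀ w, w ≤ 1 → f x / f y ≤ E * Real.exp (γ / 2 * (|y| - |x|)) →
        2 * f x * w / f y ≤ 2 * E * Real.exp (γ / 2 * (|y| - |x|)) := by
      intro w hw hb
      calc 2 * f x * w / f y ≤ 2 * f x * 1 / f y := by gcongr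
        _ = 2 * (f x / f y) := by ring
        _ ≤ 2 * (E * Real.exp (γ / 2 * (|y| - |x|))) := by gcongr
        _ = _ := by ring
    have hFy := hF0 y
    have hFy1 := hFle y
    split_ifs with hxy
    · rw [abs_of_nonneg (by linarith)]
      rcases le_total 0 y with h0 | h0
      · exact tail _ (hTR y h0)
      · refine near _ (by linarith) (b2 x y (y - x) (by linarith) ?_ (hL y x h0 hxy.le))
        rw [abs_of_nonpos h0, abs_of_nonpos (by linarith)]; ring
    · rw [zero_sub, abs_neg, abs_of_nonneg hFy]
      push Not at hxy
      rcases le_total 0 y with h0 | h0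
      · refine near _ hFy1 (b2 x y (x - y) (by linarith) ?_ (hR y x h0 hxy))
        rw [abs_of_nonneg h0, abs_of_nonneg (by linarith)]
      · exact tail _ (hTL y h0)
  have hIb : ∀ z x, |∫ y in (0:ℝ)..z, M y x| ≤ 2 * E * Real.exp (γ / 2 * (|z| - |x|)) * |z| := by
    intro z x
    have := intervalIntegral.norm_integral_le_of_norm_le_const (a := 0) (b := z)
      (f := fun y => M y x) (C := 2 * E * Real.exp (γ / 2 * (|z| - |x|))) (fun y hy => by
        refine (hMb y x).trans ?_
        have : |y| ≤ |z| := by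
          rcases Set.mem_uIoc.1 hy with h | h
          · rw [abs_of_pos h.1, abs_of_pos (h.1.trans_le h.2)]; exact h.2
          · rw [abs_of_nonpos h.2, abs_of_neg (h.1.trans_le h.2)]; linarith [h.1]
        gcongr)
    simpa using this
  have hz : ∀ z : ℝ, |z| ≤ 4 / γ * Real.exp (γ / 4 * |z|) := by
    intro z
    have := Real.add_one_le_exp (γ / 4 * |z|)
    calc |z| = 4 / γ * (γ / 4 * |z|) := by field_simp
      _ ≤ _ := by gcongr; linarith
  set Q : ℝ := (2 * E) ^ 2 * (4 / γ) ^ 2 * (D * f 0) with hQ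
  have hpt : ∀ x z, ‖(∫ y in (0:ℝ)..z, M y x) ^ 2 * f z‖ ≤
      Q * Real.exp (-γ * |x|) * Real.exp (-(γ / 2) * |z|) := by
    intro x z
    have hfz := hfp z
    rw [Real.norm_eq_abs, abs_mul, abs_pow, abs_of_pos hfz]
    calc |∫ y in (0:ℝ)..z, M y x| ^ 2 * f z
        ≤ (2 * E * Real.exp (γ / 2 * (|z| - |x|)) * (4 / γ * Real.exp (γ / 4 * |z|))) ^ 2 *
          (D * f 0 * Real.exp (-(2 * γ) * |z|)) := by
          gcongr
          · refine (hIb z x).trans ?_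
            gcongr
            exact hz z
          · exact hE z
      _ = Q * (Real.exp (γ / 2 * (|z| - |x|)) ^ 2 * Real.exp (γ / 4 * |z|) ^ 2 *
            Real.exp (-(2 * γ) * |z|)) := by rw [hQ]; ring
      _ = Q * (Real.exp (-γ * |x|) * Real.exp (-(γ / 2) * |z|)) := by
          congr 1
          rw [← Real.exp_nat_mul, ← Real.exp_nat_mul, ← Real.exp_add, ← Real.exp_add,
            ← Real.exp_add]
          congr 1
          push_cast
          ring
      _ = _ := by ring
  -- measurability
  have hFm : Measurable F := by
    apply Monotone.measurable
    intro a b hab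
    rw [hF, hF]
    exact setIntegral_mono_set hfi.integrableOn (ae_of_all _ fun x => (hfp x).le)
      (Set.Iic_subset_Iic.2 hab).eventuallyLE
  have hMm : Measurable (fun p : ℝ × ℝ => M p.1 p.2) := by
    simp only [hM]
    have hite : Measurable (fun p : ℝ × ℝ => if p.2 < p.1 then (1:ℝ) else 0) :=
      Measurable.ite (measurableSet_lt measurable_snd measurable_fst) measurable_const
        measurable_const
    have hfm := hfc.measurable
    exact ((measurable_const.mul (hfm.comp measurable_snd)).mul
      (hite.sub (hFm.comp measurable_fst))).div (hfm.comp measurable_fst)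
  have hJm : StronglyMeasurable (fun p : ℝ × ℝ => ∫ y in (0:ℝ)..p.2, M y p.1) := by
    have hMq : Measurable (fun q : (ℝ × ℝ) × ℝ => M q.2 q.1.1) :=
      hMm.comp (measurable_snd.prodMk (measurable_fst.comp measurable_fst))
    have m1 : MeasurableSet {q : (ℝ × ℝ) × ℝ | 0 < q.2 ∧ q.2 ≤ q.1.2} :=
      (measurableSet_lt measurable_const measurable_snd).inter
        (measurableSet_le measurable_snd (measurable_snd.comp measurable_fst))
    have m2 : MeasurableSet {q : (ℝ × ℝ) × ℝ | q.1.2 < q.2 ∧ q.2 ≤ 0} :=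
      (measurableSet_lt (measurable_snd.comp measurable_fst) measurable_snd).inter
        (measurableSet_le measurable_snd measurable_const)
    have s1 := (hMq.indicator m1).stronglyMeasurable.integral_prod_right' (ν := volume)
    have s2 := (hMq.indicator m2).stronglyMeasurable.integral_prod_right' (ν := volume)
    convert s1.sub s2 using 1
    funext p
    simp only [intervalIntegral, Pi.sub_apply]
    rw [← integral_indicator measurableSet_Ioc, ← integral_indicator measurableSet_Ioc]
    rfl
  have hmeas : StronglyMeasurable (fun x => ∫ z : ℝ, (∫ y in (0:ℝ)..z, M y x) ^ 2 * f z) := by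
    have : StronglyMeasurable
        (fun p : ℝ × ℝ => (∫ y in (0:ℝ)..p.2, M y p.1) ^ 2 * f p.2) :=
      (hJm.pow 2).mul (hfc.measurable.comp measurable_snd).stronglyMeasurable
    exact this.integral_prod_right' (ν := volume)
  have hi := aux_int_exp (γ / 2) (by positivity)
  refine Integrable.mono' (g := fun x => Q * (∫ z : ℝ, Real.exp (-(γ / 2) * |z|)) *
    Real.exp (-γ * |x|)) ((aux_int_exp γ hγ).const_mul _) hmeas.aestronglyMeasurable
    (ae_of_all _ fun x => ?_)
  refine (norm_integral_le_of_norm_le (hi.const_mul (Q * Real.exp (-γ * |x|)))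
    (ae_of_all _ (hpt x))).trans (le_of_eq ?_)
  rw [integral_const_mul]
  ring

/-- The double integral `∫ [ ∫ ( ∫_0^z M(y,x) dy )² f(z) dz ] dx` is finite,
where the inner integral is the signed integral from 0 to z. -/
theorem stmt_9
    (S : ℝ → ℝ) (hS : Continuous S)
    (A γ : ℝ) (hA : 0 < A) (hγ : 0 < γ)
    (hSr : ∀ x, A < x → S x ≤ -γ)
    (hSl : ∀ x, x < -A → γ ≤ S x)
    (B : ℝ → ℝ) (hB : ∀ x, B x = 2 * ∫ y in (0:ℝ)..x, S y)
    (G : ℝ) (hG : G = ∫ y : ℝ, Real.exp (B y))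
    (f : ℝ → ℝ) (hf : ∀ x, f x = Real.exp (B x) / G)
    (F : ℝ → ℝ) (hF : ∀ x, F x = ∫ y in Set.Iic x, f y)
    (M : ℝ → ℝ → ℝ)
    (hM : ∀ y x, M y x = 2 * f x * ((if x < y then (1:ℝ) else 0) - F y) / f y) :
    Integrable (fun x => ∫ z : ℝ, (∫ y in (0:ℝ)..z, M y x) ^ 2 * f z) := by
  have hBd : ∀ x, HasDerivAt B (2 * S x) x := by
    intro x
    have : B = fun x => 2 * ∫ y in (0:ℝ)..x, S y := funext hB
    rw [this]
    exact (intervalIntegral.integral_hasDerivAt_right (hS.intervalIntegrable _ _)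
      (hS.stronglyMeasurableAtFilter _ _) hS.continuousAt).const_mul 2
  have hBd' : ∀ x, HasDerivAt (fun x => B (-x)) (-(2 * S (-x))) x := by
    intro x
    simpa using! (hBd (-x)).comp x (hasDerivAt_neg x)
  have hBc : Continuous B := continuous_iff_continuousAt.2 fun x => (hBd x).continuousAt
  obtain ⟨K1, hK1, h1⟩ := aux_decay B _ hBd A (2 * γ) (fun x hx => by linarith [hSr x hx])
  obtain ⟨K2, hK2, h2⟩ := aux_decay _ _ hBd' A (2 * γ)
    (fun x hx => by linarith [hSl (-x) (by linarith)])
  set D := Real.exp (K1 + K2) with hD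
  have hB0 : B 0 = 0 := by simp [hB]
  have eR : ∀ y x, 0 ≤ y → y ≤ x →
      Real.exp (B x) ≤ D * Real.exp (B y) * Real.exp (-(2 * γ) * (x - y)) := by
    intro y x hy hyx
    rw [hD, ← Real.exp_add, ← Real.exp_add]
    apply Real.exp_le_exp.2
    linarith [h1 y x hy hyx]
  have eL : ∀ y x, y ≤ 0 → x ≤ y →
      Real.exp (B x) ≤ D * Real.exp (B y) * Real.exp (-(2 * γ) * (y - x)) := by
    intro y x hy hyx
    rw [hD, ← Real.exp_add, ← Real.exp_add]
    apply Real.exp_le_exp.2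
    have := h2 (-y) (-x) (by linarith) (by linarith)
    simp only [neg_neg] at this
    linarith
  have hexpc : Continuous (fun x => Real.exp (B x)) := Real.continuous_exp.comp hBc
  have hei : Integrable (fun x => Real.exp (B x)) := by
    refine ((aux_int_exp (2 * γ) (by positivity)).const_mul D).mono'
      hexpc.aestronglyMeasurable (ae_of_all _ fun x => ?_)
    rw [Real.norm_eq_abs, abs_of_pos (Real.exp_pos _)]
    rcases le_total 0 x with hx | hx
    · simpa [abs_of_nonneg hx, hB0] using eR 0 x le_rfl hx
    · simpa [abs_of_nonpos hx, hB0] using eL 0 x le_rfl hx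
  have hGp : 0 < G := by rw [hG]; exact integral_exp_pos hei
  have hff : f = fun x => Real.exp (B x) / G := funext hf
  refine aux_core f F M ?_ ?_ ?_ ?_ γ D hγ (Real.exp_pos _) ?_ ?_ hF hM
  · rw [hff]; exact hexpc.div_const G
  · intro x; rw [hf]; positivity
  · rw [hff]; exact hei.div_const G
  · rw [hff, integral_div, ← hG, div_self hGp.ne']
  · intro y x hy hyx
    rw [hf, hf, div_le_iff₀ hGp]
    refine (eR y x hy hyx).trans (le_of_eq ?_)
    field_simp
  · intro y x hy hyx
    rw [hf, hf, div_le_iff₀ hGp]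
    refine (eL y x hy hyx).trans (le_of_eq ?_)
    field_simp
end

section
/- There exists a constant C > 0 such that for all x with |x| > A one has ∫_ℝ ( ∫_0^z M(y,x) dy )² f(z) dz ≤ C·exp(−2γ|x|), where the inner integral ∫_0^z is the signed integral from 0 to z. -/
open MeasureTheory

lemma aux_int_exp_abs {b : ℝ} (hb : 0 < b) :
    Integrable (fun z : ℝ => Real.exp (-b * |z|)) := by
  rw [← integrableOn_univ, ← Set.Iic_union_Ioi (a := (0:ℝ))]
  refine IntegrableOn.union ?_ ?_
  · refine (integrableOn_exp_mul_Iic hb 0).congr_fun (fun z hz => ?_) measurableSet_Iic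
    have : z ≤ 0 := hz
    simp only [abs_of_nonpos this]; congr 1; ring
  · refine (integrableOn_exp_mul_Ioi (neg_lt_zero.2 hb) 0).congr_fun (fun z hz => ?_)
      measurableSet_Ioi
    have : 0 < z := hz
    simp only [abs_of_pos this]

lemma aux_int_poly {c : ℝ} (hc : 0 < c) :
    Integrable (fun z : ℝ => (1 + |z|) ^ 2 * Real.exp (-c * |z|)) := by
  refine ((aux_int_exp_abs (half_pos hc)).const_mul ((1 + 4 / c) ^ 2)).mono' ?_ ?_
  · exact Continuous.aestronglyMeasurable (by fun_prop)
  · refine Filter.Eventually.of_forall fun z => ?_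
    rw [Real.norm_of_nonneg (by positivity)]
    have h0 : 0 ≤ |z| := abs_nonneg z
    have h1 : 1 + |z| ≤ (1 + 4 / c) * Real.exp (c / 4 * |z|) := by
      have h2 := Real.add_one_le_exp (c / 4 * |z|)
      calc 1 + |z| ≤ (1 + 4 / c) * (c / 4 * |z| + 1) := by
            have : (1 + 4 / c) * (c / 4 * |z| + 1) = 1 + |z| + 4 / c + c / 4 * |z| := by
              field_simp; ring
            rw [this]
            have : 0 ≤ 4 / c := by positivity
            have : 0 ≤ c / 4 * |z| := by positivity
            linarith
        _ ≤ _ := by gcongr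
    calc (1 + |z|) ^ 2 * Real.exp (-c * |z|)
        ≤ ((1 + 4 / c) * Real.exp (c / 4 * |z|)) ^ 2 * Real.exp (-c * |z|) := by gcongr
      _ = (1 + 4 / c) ^ 2 * (Real.exp (c / 4 * |z|) * Real.exp (c / 4 * |z|)
            * Real.exp (-c * |z|)) := by ring
      _ = _ := by
          rw [← Real.exp_add, ← Real.exp_add]; congr 2; ring

lemma aux_half (f F : ℝ → ℝ) (c K : ℝ) (hc : 0 < c) (hK : 1 ≤ K)
    (hfc : Continuous f) (hfp : ∀ x, 0 < f x)
    (hr : ∀ x y, 0 ≤ x → x ≤ y → f y ≤ K * f x * Real.exp (-c * (y - x)))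
    (hl : ∀ x y, x ≤ y → y ≤ 0 → f x ≤ K * f y * Real.exp (-c * (y - x)))
    (hFm : Monotone F) (hF0 : ∀ x, 0 ≤ F x) (hF1 : ∀ x, F x ≤ 1)
    (hFl : ∀ y, y ≤ 0 → F y ≤ K / c * f y)
    (hFr : ∀ y, 0 ≤ y → 1 - F y ≤ K / c * f y) :
    ∃ C > (0:ℝ), ∀ x : ℝ, 0 < x →
      (∫ z : ℝ, (∫ y in (0:ℝ)..z, 2 * f x * ((if x < y then (1:ℝ) else 0) - F y) / f y) ^ 2
        * f z) ≤ C * Real.exp (-c * x) := by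
  have hK0 : 0 < K := by linarith
  have hf0 := hfp 0
  set P := K * f 0 with hP
  have hP0 : 0 < P := by positivity
  set D := 2 * K / c * (1 + P) with hD
  have hD0 : 0 < D := by positivity
  set p : ℝ → ℝ := fun z => (1 + |z|) ^ 2 * Real.exp (-c * |z|) with hp
  have hpi : Integrable p := aux_int_poly hc
  have hp0 : ∀ z, 0 ≤ p z := fun z => by positivity
  set J := ∫ z, p z with hJ
  have hJ0 : 0 ≤ J := integral_nonneg hp0
  refine ⟨D ^ 2 * K * (J + J) * P + 1, by positivity, fun x hx => ?_⟩
  set m : ℝ → ℝ := fun y => 2 * f x * ((if x < y then (1:ℝ) else 0) - F y) / f y with hm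
  have hfx := hfp x
  have hfxe : f x ≤ P * Real.exp (-c * x) := by simpa using hr 0 x le_rfl hx.le
  have hfxP : f x ≤ P := by
    refine hfxe.trans (mul_le_of_le_one_right hP0.le ?_)
    rw [Real.exp_le_one_iff]; nlinarith
  -- interval integrability
  have hmi : ∀ a b, IntervalIntegrable m volume a b := by
    intro a b
    have h1 : IntervalIntegrable (fun y => (if x < y then (1:ℝ) else 0)) volume a b := by
      apply Monotone.intervalIntegrable
      intro u v huv
      dsimp only
      split_ifs with h h' <;> first | (exfalso; linarith) | norm_num
    have h2 : IntervalIntegrable F volume a b := hFm.intervalIntegrable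
    have h3 := (((h1.sub h2).const_mul (2 * f x))).mul_continuousOn
      (g := fun y => (f y)⁻¹) ((hfc.inv₀ (fun y => (hfp y).ne')).continuousOn)
    simpa only [hm, div_eq_mul_inv] using h3
  have hmabs : ∀ y E, |(if x < y then (1:ℝ) else 0) - F y| ≤ E * f y → |m y| ≤ 2 * f x * E := by
    intro y E h
    have hfy := hfp y
    simp only [hm]
    rw [abs_div, abs_mul, abs_of_pos hfy, abs_of_pos (by positivity : 0 < 2 * f x),
      div_le_iff₀ hfy]
    calc _ ≤ 2 * f x * (E * f y) := by gcongr
      _ = _ := by ring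
  have hneg : ∀ z ≤ 0, |∫ y in (0:ℝ)..z, m y| ≤ 2 * f x * (K / c) * |z| := by
    intro z hz
    have := intervalIntegral.norm_integral_le_of_norm_le_const (a := 0) (b := z) (f := m)
      (C := 2 * f x * (K / c)) (fun y hy => ?_)
    · simpa using this
    · rw [Set.uIoc_of_ge hz] at hy
      apply hmabs
      rw [if_neg (by linarith [hy.2]), zero_sub, abs_neg, abs_of_nonneg (hF0 y)]
      exact hFl y hy.2
  have hmid : ∀ z, 0 ≤ z → z ≤ x → |∫ y in (0:ℝ)..z, m y| ≤ 2 * f x * K / (c * f z) := by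
    intro z hz hzx
    have hfz := hfp z
    have hg : ∫ y in (0:ℝ)..z, 2 * f x * (K / f z) * Real.exp (-c * (z - y))
        ≤ 2 * f x * K / (c * f z) := by
      have hd : ∀ y ∈ Set.uIcc 0 z, HasDerivAt
          (fun y => 2 * f x * (K / f z) * (Real.exp (-c * (z - y)) / c))
          (2 * f x * (K / f z) * Real.exp (-c * (z - y))) y := by
        intro y _
        have h1 : HasDerivAt (fun y => -c * (z - y)) c y := by
          have := ((hasDerivAt_id y).const_sub z).const_mul (-c)
          simpa using this
        have h2 := (h1.exp.div_const c).const_mul (2 * f x * (K / f z))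
        rwa [mul_div_cancel_right₀ _ hc.ne'] at h2
      rw [intervalIntegral.integral_eq_sub_of_hasDerivAt hd
        (Continuous.intervalIntegrable (by fun_prop) _ _)]
      have : 0 ≤ 2 * f x * (K / f z) * (Real.exp (-c * (z - 0)) / c) := by positivity
      have h4 : 2 * f x * (K / f z) * (Real.exp (-c * (z - z)) / c) = 2 * f x * K / (c * f z) := by
        simp; field_simp
      linarith
    refine le_trans ?_ hg
    have := intervalIntegral.norm_integral_le_of_norm_le (μ := volume) (a := 0) (b := z) (f := m)
      (g := fun y => 2 * f x * (K / f z) * Real.exp (-c * (z - y))) hz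
      (Filter.Eventually.of_forall fun y hy => ?_)
      (Continuous.intervalIntegrable (by fun_prop) _ _)
    · simpa using this
    · have hfy := hfp y
      rw [Real.norm_eq_abs, mul_assoc]
      apply hmabs
      rw [if_neg (by linarith [hy.2]), zero_sub, abs_neg, abs_of_nonneg (hF0 y)]
      refine (hF1 y).trans ?_
      have := hr y z hy.1.le hy.2
      calc (1:ℝ) = f z / f z := by field_simp
        _ ≤ (K * f y * Real.exp (-c * (z - y))) / f z := by gcongr
        _ = _ := by ring
  have hpos : ∀ z, x ≤ z → |∫ y in (0:ℝ)..z, m y| ≤ D * (1 + (z - x)) := by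
    intro z hz
    rw [← intervalIntegral.integral_add_adjacent_intervals (hmi 0 x) (hmi x z)]
    have h1 := hmid x hx.le le_rfl
    have h2 := intervalIntegral.norm_integral_le_of_norm_le_const (a := x) (b := z) (f := m)
      (C := 2 * f x * (K / c)) (fun y hy => by
        rw [Set.uIoc_of_le hz] at hy
        apply hmabs
        rw [if_pos hy.1, abs_of_nonneg (by linarith [hF1 y])]
        exact hFr y (by linarith [hy.1]))
    rw [Real.norm_eq_abs, abs_of_nonneg (by linarith : 0 ≤ z - x)] at h2
    have h3 : 2 * f x * K / (c * f x) = 2 * K / c := by field_simp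
    rw [h3] at h1
    have h4 : 2 * f x * (K / c) * (z - x) ≤ 2 * P * (K / c) * (z - x) := by
      have : 0 ≤ z - x := by linarith
      gcongr
    refine (abs_add_le _ _).trans ?_
    have h5 : D * (1 + (z - x)) = 2 * K / c + 2 * P * (K / c) * (z - x)
        + (2 * K / c * P + 2 * K / c * (z - x)) := by rw [hD]; ring
    have h6 : 0 ≤ 2 * K / c * P + 2 * K / c * (z - x) := by
      have : 0 ≤ z - x := by linarith
      positivity
    linarith
  have hbound : ∀ z, (∫ y in (0:ℝ)..z, m y) ^ 2 * f z ≤ D ^ 2 * K * f x * (p z + p (z - x)) := by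
    intro z
    have hfz := hfp z
    rw [← sq_abs]
    rcases le_total z 0 with hz | hz
    · have h1 := hneg z hz
      have h2 : f z ≤ P * Real.exp (-c * |z|) := by
        rw [abs_of_nonpos hz]; simpa using hl z 0 hz le_rfl
      calc |∫ y in (0:ℝ)..z, m y| ^ 2 * f z
          ≤ (2 * f x * (K / c) * |z|) ^ 2 * (P * Real.exp (-c * |z|)) := by gcongr
        _ = (2 * K / c) ^ 2 * f x * (f x * P) * (|z| ^ 2 * Real.exp (-c * |z|)) := by ring
        _ ≤ (2 * K / c) ^ 2 * f x * ((1 + P) ^ 2 * K) * ((1 + |z|) ^ 2 * Real.exp (-c * |z|)) := by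
            have h7 : f x * P ≤ (1 + P) ^ 2 * K :=
              calc f x * P ≤ (1 + P) * (1 + P) := by gcongr <;> linarith
                _ ≤ (1 + P) ^ 2 * K := by
                  rw [← sq]; exact le_mul_of_one_le_right (by positivity) hK
            have h8 : |z| ≤ 1 + |z| := by linarith
            exact mul_le_mul (mul_le_mul_of_nonneg_left h7 (by positivity))
              (mul_le_mul_of_nonneg_right (pow_le_pow_left₀ (abs_nonneg z) h8 2)
                (Real.exp_pos _).le) (by positivity) (by positivity)
        _ = D ^ 2 * K * f x * p z := by rw [hD, hp]; ring
        _ ≤ _ := by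
            gcongr; linarith [hp0 (z - x)]
    · rcases le_total z x with hzx | hzx
      · have h1 := hmid z hz hzx
        have h2 := hr z x hz hzx
        have h3 : |z - x| = x - z := by rw [abs_sub_comm, abs_of_nonneg (by linarith)]
        calc |∫ y in (0:ℝ)..z, m y| ^ 2 * f z
            ≤ (2 * f x * K / (c * f z)) ^ 2 * f z := by gcongr
          _ = (2 * K / c) ^ 2 * f x / f z * f x := by field_simp
          _ ≤ (2 * K / c) ^ 2 * f x / f z * (K * f z * Real.exp (-c * (x - z))) := by gcongr
          _ = (2 * K / c) ^ 2 * K * f x * (1 * Real.exp (-c * (x - z))) := by field_simp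
          _ ≤ D ^ 2 * K * f x * ((1 + |z - x|) ^ 2 * Real.exp (-c * |z - x|)) := by
              rw [h3]
              gcongr
              · rw [hD]; exact le_mul_of_one_le_right (by positivity) (by linarith)
              · have : 0 ≤ x - z := by linarith
                nlinarith
          _ = D ^ 2 * K * f x * p (z - x) := by rw [hp]
          _ ≤ _ := by
              gcongr; linarith [hp0 z]
      · have h1 := hpos z hzx
        have h2 := hr x z hx.le hzx
        have h3 : |z - x| = z - x := abs_of_nonneg (by linarith)
        calc |∫ y in (0:ℝ)..z, m y| ^ 2 * f z
            ≤ (D * (1 + (z - x))) ^ 2 * (K * f x * Real.exp (-c * (z - x))) := by gcongr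
          _ = D ^ 2 * K * f x * p (z - x) := by simp only [hp]; rw [h3]; ring
          _ ≤ _ := by
              gcongr; linarith [hp0 z]
  calc (∫ z : ℝ, (∫ y in (0:ℝ)..z, m y) ^ 2 * f z)
      ≤ ∫ z, D ^ 2 * K * f x * (p z + p (z - x)) := by
        refine integral_mono_of_nonneg (Filter.Eventually.of_forall fun z => ?_)
          ((hpi.add (hpi.comp_sub_right x)).const_mul _) (Filter.Eventually.of_forall hbound)
        have := hfp z
        show 0 ≤ (∫ y in (0:ℝ)..z, m y) ^ 2 * f z
        positivity
    _ = D ^ 2 * K * f x * (J + J) := by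
        rw [integral_const_mul, integral_add hpi (hpi.comp_sub_right x),
          integral_sub_right_eq_self p x]
    _ ≤ D ^ 2 * K * (P * Real.exp (-c * x)) * (J + J) := by gcongr
    _ ≤ _ := by
        have := Real.exp_pos (-c * x)
        nlinarith

lemma aux_tail_s10 (S : ℝ → ℝ) (hS : Continuous S) (A γ : ℝ) (hA : 0 < A)
    (hSr : ∀ x, A < x → S x ≤ -γ)
    (B : ℝ → ℝ) (hB : ∀ x, B x = 2 * ∫ y in (0:ℝ)..x, S y) :
    ∃ K ≥ (1:ℝ), ∀ x y, 0 ≤ x → x ≤ y →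
      Real.exp (B y) ≤ K * Real.exp (B x) * Real.exp (-(2 * γ) * (y - x)) := by
  have hBc : Continuous B := by
    have : B = fun x => 2 * ∫ y in (0:ℝ)..x, S y := funext hB
    rw [this]
    exact continuous_const.mul (intervalIntegral.continuous_primitive
      (fun a b => hS.intervalIntegrable a b) 0)
  have hanti : ∀ x y, A ≤ x → x ≤ y → B y + 2 * γ * y ≤ B x + 2 * γ * x := by
    intro x y hx hxy
    have h1 : B y - B x = 2 * ∫ u in x..y, S u := by
      rw [hB, hB, ← intervalIntegral.integral_interval_sub_left
        (hS.intervalIntegrable 0 y) (hS.intervalIntegrable 0 x)]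
      ring
    have h2 : ∫ u in x..y, S u ≤ ∫ u in x..y, (-γ) :=
      intervalIntegral.integral_mono_on_of_le_Ioo hxy (hS.intervalIntegrable _ _)
        intervalIntegrable_const (fun u hu => hSr u (by linarith [hu.1]))
    rw [intervalIntegral.integral_const, smul_eq_mul] at h2
    linarith
  obtain ⟨R, hR⟩ := (isCompact_Icc (a := (0:ℝ)) (b := A)).exists_bound_of_continuousOn
    (f := fun x => B x + 2 * γ * x) (by fun_prop)
  have hR0 : 0 ≤ R := (norm_nonneg _).trans (hR 0 ⟨le_rfl, hA.le⟩)
  have hR' : ∀ x, 0 ≤ x → x ≤ A → |B x + 2 * γ * x| ≤ R := fun x h1 h2 => hR x ⟨h1, h2⟩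
  refine ⟨Real.exp (2 * R), Real.one_le_exp (by linarith), fun x y hx hxy => ?_⟩
  rw [← Real.exp_add, ← Real.exp_add, Real.exp_le_exp]
  have key : (B y + 2 * γ * y) - (B x + 2 * γ * x) ≤ 2 * R := by
    rcases le_total x A with h | h
    · have h1 := abs_le.1 (hR' x hx h)
      rcases le_total y A with h' | h'
      · have h2 := abs_le.1 (hR' y (hx.trans hxy) h')
        linarith
      · have h2 := abs_le.1 (hR' A hA.le le_rfl)
        have h3 := hanti A y le_rfl h'
        linarith
    · have := hanti x y h hxy
      linarith
  linarith

/-- There is `C > 0` such that for `|x| > A`,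
`∫ ( ∫_0^z M(y,x) dy )² f(z) dz ≤ C·exp(−2γ|x|)`. -/
theorem stmt_10
    (S : ℝ → ℝ) (hS : Continuous S)
    (A γ : ℝ) (hA : 0 < A) (hγ : 0 < γ)
    (hSr : ∀ x, A < x → S x ≤ -γ)
    (hSl : ∀ x, x < -A → γ ≤ S x)
    (B : ℝ → ℝ) (hB : ∀ x, B x = 2 * ∫ y in (0:ℝ)..x, S y)
    (G : ℝ) (hG : G = ∫ y : ℝ, Real.exp (B y))
    (f : ℝ → ℝ) (hf : ∀ x, f x = Real.exp (B x) / G)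
    (F : ℝ → ℝ) (hF : ∀ x, F x = ∫ y in Set.Iic x, f y)
    (M : ℝ → ℝ → ℝ)
    (hM : ∀ y x, M y x = 2 * f x * ((if x < y then (1:ℝ) else 0) - F y) / f y) :
    ∃ C > (0:ℝ), ∀ x : ℝ, A < |x| →
      (∫ z : ℝ, (∫ y in (0:ℝ)..z, M y x) ^ 2 * f z) ≤
        C * Real.exp (-2 * γ * |x|) := by
  have hBc : Continuous B := by
    have : B = fun x => 2 * ∫ y in (0:ℝ)..x, S y := funext hB
    rw [this]
    exact continuous_const.mul (intervalIntegral.continuous_primitive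
      (fun a b => hS.intervalIntegrable a b) 0)
  obtain ⟨K₁, hK₁, hr₁⟩ := aux_tail_s10 S hS A γ hA hSr B hB
  obtain ⟨K₂, hK₂, hl₁⟩ := aux_tail_s10 (fun x => - S (-x)) (by fun_prop) A γ hA
    (fun x hx => neg_le_neg (hSl (-x) (by linarith))) (fun x => B (-x)) (fun x => by
      rw [hB, intervalIntegral.integral_neg, intervalIntegral.integral_comp_neg,
        intervalIntegral.integral_symm]
      simp)
  set c := 2 * γ with hc_def
  have hc : 0 < c := by positivity
  set K := max K₁ K₂ with hK_def
  have hK : 1 ≤ K := le_max_of_le_left hK₁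
  have hK0 : 0 < K := by linarith
  have hr₂ : ∀ x y, 0 ≤ x → x ≤ y →
      Real.exp (B y) ≤ K * Real.exp (B x) * Real.exp (-c * (y - x)) := fun x y h1 h2 =>
    (hr₁ x y h1 h2).trans (by gcongr; exact le_max_left _ _)
  have hl₂ : ∀ x y, x ≤ y → y ≤ 0 →
      Real.exp (B x) ≤ K * Real.exp (B y) * Real.exp (-c * (y - x)) := fun x y h1 h2 => by
    have := hl₁ (-y) (-x) (by linarith) (by linarith)
    simp only [neg_neg] at this
    rw [show -x - -y = y - x by ring] at this
    exact this.trans (by gcongr; exact le_max_right _ _)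
  have hei : Integrable (fun y => Real.exp (B y)) := by
    refine ((aux_int_exp_abs hc).const_mul (K * Real.exp (B 0))).mono' ?_ ?_
    · exact Continuous.aestronglyMeasurable (by fun_prop)
    · refine Filter.Eventually.of_forall fun z => ?_
      rw [Real.norm_of_nonneg (Real.exp_pos _).le]
      rcases le_total z 0 with hz | hz
      · rw [abs_of_nonpos hz]; simpa using hl₂ z 0 hz le_rfl
      · rw [abs_of_nonneg hz]; simpa using hr₂ 0 z le_rfl hz
  have hG0 : 0 < G := by
    rw [hG]; exact integral_exp_pos hei
  have hfe : f = fun x => Real.exp (B x) / G := funext hf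
  have hfp : ∀ x, 0 < f x := fun x => by rw [hf]; positivity
  have hfc : Continuous f := by rw [hfe]; fun_prop
  have hfi : Integrable f := by rw [hfe]; exact hei.div_const G
  have hf1 : ∫ y, f y = 1 := by
    rw [hfe, integral_div, ← hG, div_self hG0.ne']
  have hr : ∀ x y, 0 ≤ x → x ≤ y → f y ≤ K * f x * Real.exp (-c * (y - x)) := fun x y h1 h2 => by
    rw [hf, hf, div_le_iff₀ hG0]
    refine (hr₂ x y h1 h2).trans_eq ?_
    field_simp
  have hl : ∀ x y, x ≤ y → y ≤ 0 → f x ≤ K * f y * Real.exp (-c * (y - x)) := fun x y h1 h2 => by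
    rw [hf, hf, div_le_iff₀ hG0]
    refine (hl₂ x y h1 h2).trans_eq ?_
    field_simp
  have hFc : ∀ y, 1 - F y = ∫ u in Set.Ioi y, f u := fun y => by
    rw [← hf1, hF, ← intervalIntegral.integral_Iic_add_Ioi (b := y) hfi.integrableOn
      hfi.integrableOn]
    ring
  have hF0 : ∀ x, 0 ≤ F x := fun x => by
    rw [hF]; exact integral_nonneg fun u => (hfp u).le
  have hF1 : ∀ x, F x ≤ 1 := fun x => by
    have : 0 ≤ 1 - F x := by rw [hFc]; exact integral_nonneg fun u => (hfp u).le
    linarith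
  have hFm : Monotone F := fun x y hxy => by
    rw [hF, hF]
    exact setIntegral_mono_set hfi.integrableOn (Filter.Eventually.of_forall fun u => (hfp u).le)
      (Set.Iic_subset_Iic.2 hxy).eventuallyLE
  have hFl : ∀ y, y ≤ 0 → F y ≤ K / c * f y := fun y hy => by
    have hi : IntegrableOn (fun u => K * f y * Real.exp (-c * y) * Real.exp (c * u))
      (Set.Iic y) := (integrableOn_exp_mul_Iic hc y).const_mul _
    have h1 : F y ≤ ∫ u in Set.Iic y, K * f y * Real.exp (-c * y) * Real.exp (c * u) := by
      rw [hF]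
      refine setIntegral_mono_on hfi.integrableOn hi measurableSet_Iic fun u hu => ?_
      refine (hl u y hu hy).trans_eq ?_
      rw [mul_assoc _ (Real.exp _), ← Real.exp_add]; congr 2; ring
    rw [integral_const_mul, integral_exp_mul_Iic hc] at h1
    refine h1.trans_eq ?_
    have : Real.exp (-c * y) * Real.exp (c * y) = 1 := by
      rw [← Real.exp_add]; simp
    calc _ = K / c * f y * (Real.exp (-c * y) * Real.exp (c * y)) := by ring
      _ = _ := by rw [this, mul_one]
  have hFr : ∀ y, 0 ≤ y → 1 - F y ≤ K / c * f y := fun y hy => by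
    have hi : IntegrableOn (fun u => K * f y * Real.exp (c * y) * Real.exp (-c * u))
      (Set.Ioi y) := (integrableOn_exp_mul_Ioi (neg_lt_zero.2 hc) y).const_mul _
    have h1 : 1 - F y ≤ ∫ u in Set.Ioi y, K * f y * Real.exp (c * y) * Real.exp (-c * u) := by
      rw [hFc]
      refine setIntegral_mono_on hfi.integrableOn hi measurableSet_Ioi fun u hu => ?_
      refine (hr y u hy (le_of_lt hu)).trans_eq ?_
      rw [mul_assoc _ (Real.exp _), ← Real.exp_add]; congr 2; ring
    rw [integral_const_mul, integral_exp_mul_Ioi (neg_lt_zero.2 hc)] at h1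
    refine h1.trans_eq ?_
    have : Real.exp (c * y) * Real.exp (-c * y) = 1 := by
      rw [← Real.exp_add]; simp
    rw [neg_div_neg_eq]
    calc _ = K / c * f y * (Real.exp (c * y) * Real.exp (-c * y)) := by ring
      _ = _ := by rw [this, mul_one]
  obtain ⟨C₁, hC₁, h₁⟩ := aux_half f F c K hc hK hfc hfp hr hl hFm hF0 hF1 hFl hFr
  obtain ⟨C₂, hC₂, h₂⟩ := aux_half (fun x => f (-x)) (fun x => 1 - F (-x)) c K hc hK
    (by fun_prop) (fun x => hfp _)
    (fun x y hx hxy => by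
      have := hl (-y) (-x) (by linarith) (by linarith)
      rwa [show -x - -y = y - x by ring] at this)
    (fun x y hxy hy => by
      have := hr (-y) (-x) (by linarith) (by linarith)
      rwa [show -x - -y = y - x by ring] at this)
    (fun x y hxy => by
      have := hFm (neg_le_neg hxy)
      dsimp only; linarith)
    (fun x => by linarith [hF1 (-x)]) (fun x => by linarith [hF0 (-x)])
    (fun y hy => hFr (-y) (by linarith))
    (fun y hy => by
      have := hFl (-y) (by linarith)
      linarith)
  refine ⟨max C₁ C₂, lt_max_of_lt_left hC₁, fun x hx => ?_⟩
  have hcc : -2 * γ * |x| = -c * |x| := by rw [hc_def]; ring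
  rw [hcc]
  rcases le_total 0 x with h | h
  · rw [abs_of_nonneg h] at hx ⊢
    have := h₁ x (by linarith)
    simp only [hM]
    exact this.trans (by gcongr; exact le_max_left _ _)
  · rw [abs_of_nonpos h] at hx ⊢
    have h3 := h₂ (-x) (by linarith)
    refine le_trans (le_of_eq ?_) (h3.trans (by gcongr; exact le_max_right _ _))
    rw [← integral_neg_eq_self]
    refine integral_congr_ae (Filter.Eventually.of_forall fun z => ?_)
    dsimp only
    congr 2
    have h4 : ∫ y in (0:ℝ)..(-z), M y x = - ∫ y in (0:ℝ)..z, M (-y) x := by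
      rw [intervalIntegral.integral_comp_neg (fun y => M y x), intervalIntegral.integral_symm]
      simp
    rw [h4, ← intervalIntegral.integral_neg]
    refine intervalIntegral.integral_congr_ae ?_
    filter_upwards [Measure.ae_ne volume (-x)] with y hy _
    rw [hM, neg_neg]
    have hite : (if x < -y then (1:ℝ) else 0) = 1 - (if -x < y then (1:ℝ) else 0) := by
      rcases lt_or_gt_of_ne hy with h5 | h5
      · rw [if_pos (by linarith), if_neg (by linarith)]; ring
      · rw [if_neg (by linarith), if_pos h5]; ring
    rw [hite]
    ring
end

section
/- The function z ↦ ( ∫_z^0 F(y)/f(y) dy )² · f(z) is integrable on the half-line (−∞, −A], i.e. ∫_{−∞}^{−A} ( ∫_z^0 F(y)/f(y) dy )² f(z) dz < ∞. -/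
open MeasureTheory

/-- The function `z ↦ ( ∫_z^0 F(y)/f(y) dy )² · f(z)` is integrable on
`(−∞, −A]`. -/
theorem stmt_11
    (S : ℝ → ℝ) (hS : Continuous S)
    (A γ : ℝ) (hA : 0 < A) (hγ : 0 < γ)
    (hSr : ∀ x, A < x → S x ≤ -γ)
    (hSl : ∀ x, x < -A → γ ≤ S x)
    (B : ℝ → ℝ) (hB : ∀ x, B x = 2 * ∫ y in (0:ℝ)..x, S y)
    (G : ℝ) (hG : G = ∫ y : ℝ, Real.exp (B y))
    (f : ℝ → ℝ) (hf : ∀ x, f x = Real.exp (B x) / G)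
    (F : ℝ → ℝ) (hF : ∀ x, F x = ∫ y in Set.Iic x, f y) :
    IntegrableOn (fun z => (∫ y in z..(0:ℝ), F y / f y) ^ 2 * f z)
      (Set.Iic (-A)) := by
  by_cases hG0 : G = 0
  · have : ∀ x, f x = 0 := fun x => by rw [hf, hG0, div_zero]
    simp [this]
  have hGpos : 0 < G := lt_of_le_of_ne
    (by rw [hG]; exact integral_nonneg fun _ => (Real.exp_pos _).le) (Ne.symm hG0)
  have hint : ∀ a b, IntervalIntegrable S volume a b := fun a b => hS.intervalIntegrable a b
  have hBc : Continuous B := by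
    have : B = fun x => 2 * ∫ y in (0:ℝ)..x, S y := funext hB
    rw [this]
    exact continuous_const.mul (intervalIntegral.continuous_primitive hint 0)
  have hfc : Continuous f := by
    have : f = fun x => Real.exp (B x) / G := funext hf
    rw [this]
    exact (Real.continuous_exp.comp hBc).div_const G
  have hfpos : ∀ x, 0 < f x := fun x => by rw [hf]; exact div_pos (Real.exp_pos _) hGpos
  have hBle : ∀ y x, y ≤ x → x ≤ -A → B y ≤ B x + 2 * γ * (y - x) := by
    intro y x hyx hx
    have h1 : (∫ t in (0:ℝ)..x, S t) - ∫ t in (0:ℝ)..y, S t = ∫ t in y..x, S t :=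
      intervalIntegral.integral_interval_sub_left (hint _ _) (hint _ _)
    have h2 : ∫ t in y..x, γ ≤ ∫ t in y..x, S t :=
      intervalIntegral.integral_mono_on_of_le_Ioo hyx (by simp) (hint _ _)
        (fun t ht => hSl t (lt_of_lt_of_le ht.2 hx))
    rw [intervalIntegral.integral_const, smul_eq_mul] at h2
    rw [hB, hB]
    nlinarith
  have hfle : ∀ y x, y ≤ x → x ≤ -A →
      f y ≤ f x * Real.exp (-(2 * γ * x)) * Real.exp (2 * γ * y) := by
    intro y x hyx hx
    have h1 : Real.exp (B y) ≤ Real.exp (B x) * Real.exp (-(2 * γ * x)) * Real.exp (2 * γ * y) := by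
      rw [← Real.exp_add, ← Real.exp_add]
      apply Real.exp_le_exp.2
      have := hBle y x hyx hx
      linarith
    rw [hf, hf, div_mul_eq_mul_div, div_mul_eq_mul_div]
    gcongr
  have h2γ : 0 < 2 * γ := by positivity
  have hfint1 : ∀ x, x ≤ -A → IntegrableOn f (Set.Iic x) := by
    intro x hx
    refine Integrable.mono' ((integrableOn_exp_mul_Iic h2γ x).const_mul
      (f x * Real.exp (-(2 * γ * x)))) hfc.aestronglyMeasurable ?_
    refine (ae_restrict_iff' measurableSet_Iic).2 (Filter.Eventually.of_forall fun y hy => ?_)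
    rw [Real.norm_of_nonneg (hfpos y).le]
    exact hfle y x hy hx
  have hfint : ∀ x, IntegrableOn f (Set.Iic x) := by
    intro x
    refine ((hfint1 (-A) le_rfl).union (hfc.integrableOn_Icc (a := -A) (b := x))).mono_set ?_
    intro t ht
    rcases le_total t (-A) with h | h
    · exact Or.inl h
    · exact Or.inr ⟨h, ht⟩
  have hFc : Continuous F := by
    have : F = fun x => F 0 + ∫ t in (0:ℝ)..x, f t := by
      funext x
      rw [hF, hF, ← intervalIntegral.integral_Iic_sub_Iic (hfint 0) (hfint x)]
      ring
    rw [this]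
    exact continuous_const.add
      (intervalIntegral.continuous_primitive (fun a b => hfc.intervalIntegrable a b) 0)
  have hFnn : ∀ x, 0 ≤ F x := fun x => by
    rw [hF]; exact integral_nonneg fun y => (hfpos y).le
  have hqc : Continuous fun y => F y / f y := hFc.div hfc fun x => (hfpos x).ne'
  have hqle : ∀ y, y ≤ -A → F y / f y ≤ 1 / (2 * γ) := by
    intro y hy
    rw [div_le_iff₀ (hfpos y), hF]
    calc ∫ t in Set.Iic y, f t
        ≤ ∫ t in Set.Iic y, f y * Real.exp (-(2 * γ * y)) * Real.exp (2 * γ * t) :=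
          setIntegral_mono_on (hfint y) ((integrableOn_exp_mul_Iic h2γ y).const_mul _)
            measurableSet_Iic (fun t ht => hfle t y ht hy)
      _ = f y * Real.exp (-(2 * γ * y)) * (Real.exp (2 * γ * y) / (2 * γ)) := by
          rw [integral_const_mul, integral_exp_mul_Iic h2γ]
      _ = 1 / (2 * γ) * f y := by
          rw [Real.exp_neg]
          field_simp
  obtain ⟨M, hM⟩ := (isCompact_Icc (a := -A) (b := (0:ℝ))).exists_bound_of_continuousOn
    hqc.continuousOn
  set K := max M (1 / (2 * γ)) with hK
  have hqK : ∀ y, y ≤ 0 → ‖F y / f y‖ ≤ K := by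
    intro y hy
    rcases le_total y (-A) with h | h
    · rw [Real.norm_of_nonneg (div_nonneg (hFnn y) (hfpos y).le)]
      exact (hqle y h).trans (le_max_right _ _)
    · exact (hM y ⟨h, hy⟩).trans (le_max_left _ _)
  have hIc : Continuous fun z => ∫ y in z..(0:ℝ), F y / f y := by
    have : (fun z => ∫ y in z..(0:ℝ), F y / f y) = fun z => -∫ y in (0:ℝ)..z, F y / f y := by
      funext z; rw [intervalIntegral.integral_symm]
    rw [this]
    exact (intervalIntegral.continuous_primitive (fun a b => hqc.intervalIntegrable a b) 0).neg
  refine Integrable.mono' ((integrableOn_exp_mul_Iic hγ (-A)).const_mul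
    (K ^ 2 * (2 / γ ^ 2) * (f (-A) * Real.exp (-(2 * γ * (-A))))))
    ((hIc.pow 2).mul hfc).aestronglyMeasurable ?_
  refine (ae_restrict_iff' measurableSet_Iic).2 (Filter.Eventually.of_forall fun z hz => ?_)
  have hz' : z ≤ -A := hz
  have hz0 : z ≤ 0 := by linarith
  rw [Real.norm_of_nonneg (mul_nonneg (sq_nonneg _) (hfpos z).le)]
  have h1 : ‖∫ y in z..(0:ℝ), F y / f y‖ ≤ K * |0 - z| :=
    intervalIntegral.norm_integral_le_of_norm_le_const fun y hy => by
      rw [Set.uIoc_of_le hz0] at hy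
      exact hqK y hy.2
  have h2 : (∫ y in z..(0:ℝ), F y / f y) ^ 2 ≤ K ^ 2 * z ^ 2 := by
    rw [← sq_abs, ← Real.norm_eq_abs]
    calc _ ≤ (K * |0 - z|) ^ 2 := pow_le_pow_left₀ (norm_nonneg _) h1 2
      _ = _ := by rw [mul_pow, sq_abs]; ring
  have h3 : z ^ 2 ≤ 2 / γ ^ 2 * Real.exp (-(γ * z)) := by
    have h0 : 0 ≤ -(γ * z) := by nlinarith
    have := Real.quadratic_le_exp_of_nonneg h0
    rw [div_mul_eq_mul_div, le_div_iff₀ (by positivity)]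
    nlinarith
  calc _ ≤ (K ^ 2 * (2 / γ ^ 2 * Real.exp (-(γ * z)))) *
        (f (-A) * Real.exp (-(2 * γ * (-A))) * Real.exp (2 * γ * z)) := by
        refine mul_le_mul (h2.trans (mul_le_mul_of_nonneg_left h3 (sq_nonneg _)))
          (hfle z (-A) hz' le_rfl) (hfpos z).le (by positivity)
    _ = _ := by
        have : Real.exp (γ * z) = Real.exp (-(γ * z)) * Real.exp (2 * γ * z) := by
          rw [← Real.exp_add]; congr 1; ring
        rw [this]; ring
end

section
/- There exists a constant C > 0 such that for all x > A one has f(x)² · ∫_x^∞ ( ∫_x^z (1 − F(y))/f(y) dy )² f(z) dz ≤ C·exp(−6γx). -/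
open MeasureTheory

lemma exp_tail (c y : ℝ) (hc : 0 < c) :
    IntegrableOn (fun u => Real.exp (-c * (u - y))) (Set.Ioi y) ∧
      ∫ u in Set.Ioi y, Real.exp (-c * (u - y)) = 1 / c := by
  have e : (fun u => Real.exp (-c * (u - y))) =
      fun u => Real.exp (c * y) * Real.exp (-c * u) := by
    funext u; rw [← Real.exp_add]; congr 1; ring
  rw [e]
  constructor
  · exact (integrableOn_exp_mul_Ioi (by linarith) y).const_mul _
  · rw [integral_const_mul, integral_exp_mul_Ioi (by linarith)]
    have : Real.exp (c * y) * Real.exp (-c * y) = 1 := by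
      rw [← Real.exp_add]; simp
    rw [neg_mul] at this ⊢
    field_simp
    linarith

/-- There is `C > 0` such that for all `x > A`,
`f(x)² ∫_x^∞ ( ∫_x^z (1−F(y))/f(y) dy )² f(z) dz ≤ C·exp(−6γx)`. -/
theorem stmt_12
    (S : ℝ → ℝ) (hS : Continuous S)
    (A γ : ℝ) (hA : 0 < A) (hγ : 0 < γ)
    (hSr : ∀ x, A < x → S x ≤ -γ)
    (hSl : ∀ x, x < -A → γ ≤ S x)
    (B : ℝ → ℝ) (hB : ∀ x, B x = 2 * ∫ y in (0:ℝ)..x, S y)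
    (G : ℝ) (hG : G = ∫ y : ℝ, Real.exp (B y))
    (f : ℝ → ℝ) (hf : ∀ x, f x = Real.exp (B x) / G)
    (F : ℝ → ℝ) (hF : ∀ x, F x = ∫ y in Set.Iic x, f y) :
    ∃ C > (0:ℝ), ∀ x, A < x →
      f x ^ 2 * (∫ z in Set.Ioi x, (∫ y in x..z, (1 - F y) / f y) ^ 2 * f z) ≤
        C * Real.exp (-6 * γ * x) := by
  have hint : ∀ a b, IntervalIntegrable S volume a b := fun a b => hS.intervalIntegrable a b
  have hdiff : ∀ x z, B z - B x = 2 * ∫ y in x..z, S y := by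
    intro x z
    rw [hB, hB, ← mul_sub, intervalIntegral.integral_interval_sub_left (hint _ _) (hint _ _)]
  have hBr : ∀ x z, A ≤ x → x ≤ z → B z ≤ B x + -(2 * γ) * (z - x) := by
    intro x z hx hz
    have h1 : ∫ y in x..z, S y ≤ ∫ y in x..z, (-γ) := by
      apply intervalIntegral.integral_mono_on_of_le_Ioo hz (hint _ _) (by simp)
      intro y hy
      exact hSr y (by linarith [hy.1])
    rw [intervalIntegral.integral_const, smul_eq_mul] at h1
    linarith [hdiff x z]
  have hBl : ∀ x z, z ≤ -A → x ≤ z → B x ≤ B z + (2 * γ) * (x - z) := by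
    intro x z hx hz
    have h1 : ∫ y in x..z, γ ≤ ∫ y in x..z, S y := by
      apply intervalIntegral.integral_mono_on_of_le_Ioo hz (by simp) (hint _ _)
      intro y hy
      exact hSl y (by linarith [hy.2])
    rw [intervalIntegral.integral_const, smul_eq_mul] at h1
    linarith [hdiff x z]
  have hBc : Continuous B := by
    have : B = fun x => 2 * ∫ y in (0:ℝ)..x, S y := funext hB
    rw [this]
    exact continuous_const.mul (intervalIntegral.continuous_primitive hint 0)
  have hec : Continuous fun x => Real.exp (B x) := Real.continuous_exp.comp hBc
  have hei : Integrable fun x => Real.exp (B x) := by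
    have hr : IntegrableOn (fun x => Real.exp (B x)) (Set.Ioi A) := by
      refine Integrable.mono' ((exp_tail (2 * γ) A (by linarith)).1.const_mul (Real.exp (B A)))
        hec.aestronglyMeasurable ?_
      refine (ae_restrict_iff' measurableSet_Ioi).2 (ae_of_all _ fun x hx => ?_)
      rw [Real.norm_of_nonneg (Real.exp_pos _).le, ← Real.exp_add]
      exact Real.exp_le_exp.2 (hBr A x le_rfl (le_of_lt hx))
    have hl : IntegrableOn (fun x => Real.exp (B x)) (Set.Iic (-A)) := by
      refine Integrable.mono' ((integrableOn_exp_mul_Iic (a := 2 * γ) (by linarith)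
        (-A)).const_mul (Real.exp (B (-A) + 2 * γ * A)))
        hec.aestronglyMeasurable ?_
      refine (ae_restrict_iff' measurableSet_Iic).2 (ae_of_all _ fun x hx => ?_)
      rw [Real.norm_of_nonneg (Real.exp_pos _).le, ← Real.exp_add]
      apply Real.exp_le_exp.2
      have := hBl x (-A) le_rfl hx
      linarith
    have hm : IntegrableOn (fun x => Real.exp (B x)) (Set.Icc (-A) A) :=
      hec.continuousOn.integrableOn_compact isCompact_Icc
    rw [← integrableOn_univ]
    refine ((hl.union hm).union hr).mono_set ?_
    intro x _
    simp only [Set.mem_union, Set.mem_Iic, Set.mem_Icc, Set.mem_Ioi]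
    by_cases h1 : x ≤ -A
    · exact Or.inl (Or.inl h1)
    · by_cases h2 : x ≤ A
      · exact Or.inl (Or.inr ⟨by linarith, h2⟩)
      · exact Or.inr (by linarith)
  have hGpos : 0 < G := by
    rw [hG]; exact integral_exp_pos hei
  have hfe : f = fun x => Real.exp (B x) / G := funext hf
  have hfi : Integrable f := by rw [hfe]; exact hei.div_const G
  have hf1 : ∫ x, f x = 1 := by
    rw [hfe, integral_div, ← hG, div_self hGpos.ne']
  have hfpos : ∀ x, 0 < f x := fun x => by rw [hf]; positivity
  have hfr : ∀ x z, A ≤ x → x ≤ z → f z ≤ f x * Real.exp (-(2 * γ) * (z - x)) := by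
    intro x z hx hz
    rw [hf, hf, div_mul_eq_mul_div, ← Real.exp_add]
    gcongr
    exact hBr x z hx hz
  have hF1 : ∀ y, 1 - F y = ∫ u in Set.Ioi y, f u := by
    intro y
    have := intervalIntegral.integral_Iic_add_Ioi (b := y) hfi.integrableOn hfi.integrableOn
    rw [hF, ← hf1]; linarith
  have hq : ∀ y, A ≤ y → |(1 - F y) / f y| ≤ 1 / (2 * γ) := by
    intro y hy
    have h0 : 0 ≤ 1 - F y := by
      rw [hF1]; exact integral_nonneg fun u => (hfpos u).le
    rw [abs_of_nonneg (div_nonneg h0 (hfpos y).le), div_le_iff₀ (hfpos y), hF1]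
    obtain ⟨i1, i2⟩ := exp_tail (2 * γ) y (by linarith)
    calc ∫ u in Set.Ioi y, f u ≤ ∫ u in Set.Ioi y, f y * Real.exp (-(2 * γ) * (u - y)) :=
          setIntegral_mono_on hfi.integrableOn (i1.const_mul _) measurableSet_Ioi
            fun u hu => hfr y u hy (le_of_lt hu)
      _ = 1 / (2 * γ) * f y := by rw [integral_const_mul, i2]; ring
  have hin : ∀ x, A < x → ∀ z, x < z →
      (∫ y in x..z, (1 - F y) / f y) ^ 2 * f z ≤
        (f x / (2 * γ ^ 4)) * Real.exp (-γ * (z - x)) := by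
    intro x hx z hz
    have h1 : |∫ y in x..z, (1 - F y) / f y| ≤ 1 / (2 * γ) * |z - x| := by
      rw [← Real.norm_eq_abs (∫ y in x..z, (1 - F y) / f y)]
      apply intervalIntegral.norm_integral_le_of_norm_le_const
      intro y hy
      rw [Set.uIoc_of_le hz.le] at hy
      exact hq y (by linarith [hy.1])
    have h2 : (∫ y in x..z, (1 - F y) / f y) ^ 2 ≤ (1 / (2 * γ) * |z - x|) ^ 2 := by
      rw [← sq_abs]; gcongr
    have h3 : (γ * (z - x)) ^ 2 / 2 ≤ Real.exp (γ * (z - x)) := by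
      have h := Real.quadratic_le_exp_of_nonneg (x := γ * (z - x))
        (mul_nonneg hγ.le (by linarith))
      have : 0 ≤ γ * (z - x) := mul_nonneg hγ.le (by linarith)
      linarith
    have h4 : (1 / (2 * γ) * |z - x|) ^ 2 ≤ 1 / (2 * γ ^ 4) * Real.exp (γ * (z - x)) := by
      calc (1 / (2 * γ) * |z - x|) ^ 2 = 1 / (2 * γ ^ 4) * ((γ * (z - x)) ^ 2 / 2) := by
            rw [mul_pow, sq_abs]; field_simp
        _ ≤ _ := by gcongr
    calc (∫ y in x..z, (1 - F y) / f y) ^ 2 * f z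
        ≤ (1 / (2 * γ ^ 4) * Real.exp (γ * (z - x))) *
            (f x * Real.exp (-(2 * γ) * (z - x))) := by
          have := hfpos z
          exact mul_le_mul (h2.trans h4) (hfr x z hx.le hz.le) this.le (by positivity)
      _ = (f x / (2 * γ ^ 4)) * (Real.exp (γ * (z - x)) * Real.exp (-(2 * γ) * (z - x))) := by
          ring
      _ = _ := by rw [← Real.exp_add]; congr 2; ring
  refine ⟨(f A * Real.exp (2 * γ * A)) ^ 3 / (2 * γ ^ 5),
    by have := hfpos A; positivity, fun x hx => ?_⟩
  obtain ⟨i1, i2⟩ := exp_tail γ x hγ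
  have hI : (∫ z in Set.Ioi x, (∫ y in x..z, (1 - F y) / f y) ^ 2 * f z) ≤
      f x / (2 * γ ^ 5) := by
    calc _ ≤ ∫ z in Set.Ioi x, (f x / (2 * γ ^ 4)) * Real.exp (-γ * (z - x)) := by
          apply integral_mono_of_nonneg
          · exact ae_of_all _ fun z => mul_nonneg (sq_nonneg _) (hfpos z).le
          · exact i1.const_mul _
          · exact (ae_restrict_iff' measurableSet_Ioi).2 (ae_of_all _ fun z hz => hin x hx z hz)
      _ = _ := by rw [integral_const_mul, i2]; field_simp
  have hx3 : f x ^ 3 ≤ (f A * Real.exp (-(2 * γ) * (x - A))) ^ 3 := by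
    have := hfpos x
    have := hfr A x le_rfl hx.le
    gcongr
  calc _ ≤ f x ^ 2 * (f x / (2 * γ ^ 5)) := by gcongr
    _ = f x ^ 3 / (2 * γ ^ 5) := by ring
    _ ≤ (f A * Real.exp (-(2 * γ) * (x - A))) ^ 3 / (2 * γ ^ 5) := by gcongr
    _ = _ := by
      have e : Real.exp (-(2 * γ) * (x - A)) ^ 3 =
          Real.exp (2 * γ * A) ^ 3 * Real.exp (-6 * γ * x) := by
        rw [← Real.exp_nat_mul, ← Real.exp_nat_mul, ← Real.exp_add]
        congr 1; push_cast; ring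
      rw [mul_pow, mul_pow, e]; ring
end

section
/- There exists a constant C > 0 such that for all x with |x| > A one has ∫_ℝ M(y,x)² f(y) dy ≤ C·exp(−2γ|x|); equivalently, 4 f(x)² ∫_ℝ (1_{{y>x}} − F(y))²/f(y) dy ≤ C·exp(−2γ|x|). -/
open MeasureTheory

/-- Two-sided exponentials are integrable. -/
theorem aux_exp_abs_integrable (γ : ℝ) (hγ : 0 < γ) :
    Integrable (fun t : ℝ => Real.exp (-2 * γ * |t|)) := by
  rw [← integrableOn_univ, ← Set.Iic_union_Ioi (a := (0:ℝ))]
  refine IntegrableOn.union ?_ ?_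
  · refine (integrableOn_exp_mul_Iic (a := 2 * γ) (by linarith) 0).congr_fun ?_ measurableSet_Iic
    intro t ht
    simp only [Set.mem_Iic] at ht
    simp only [abs_of_nonpos ht]
    congr 1; ring
  · refine (integrableOn_exp_mul_Ioi (a := -2 * γ) (by linarith) 0).congr_fun ?_ measurableSet_Ioi
    intro t ht
    simp only [Set.mem_Ioi] at ht
    simp only [abs_of_pos ht]

/-- The pointwise estimate used for every region. -/
theorem aux_alg1 {a b n K L : ℝ} (ha : 0 < a) (hb : 0 < b) (hn : 0 ≤ n) (hnb : n ≤ K * b)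
    (haL : a ≤ L) : 4 * a ^ 2 * (n ^ 2 / b) ≤ 4 * a * (L * K ^ 2 * b) := by
  have h1 : n ^ 2 / b ≤ K ^ 2 * b := by
    rw [div_le_iff₀ hb]
    calc n ^ 2 ≤ (K * b) ^ 2 := by gcongr
      _ = _ := by ring
  have h0 : 0 ≤ n ^ 2 / b := by positivity
  calc 4 * a ^ 2 * (n ^ 2 / b) = 4 * a * (a * (n ^ 2 / b)) := by ring
    _ ≤ 4 * a * (L * (K ^ 2 * b)) := by
        have : 0 ≤ L := ha.le.trans haL
        gcongr
    _ = _ := by ring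

theorem aux_alg2 {a b n E : ℝ} (ha : 0 < a) (hb : 0 < b) (hn : 0 ≤ n) (hn1 : n ≤ 1)
    (hab : a ≤ b * E) : 4 * a ^ 2 * (n ^ 2 / b) ≤ 4 * a * E := by
  have h1 : n ^ 2 ≤ 1 := by nlinarith
  have h2 : a / b ≤ E := by
    rw [div_le_iff₀ hb]; linarith
  calc 4 * a ^ 2 * (n ^ 2 / b) = 4 * a * (n ^ 2 * (a / b)) := by ring
    _ ≤ 4 * a * (1 * E) := by gcongr
    _ = _ := by ring

/-- There is `C > 0` such that for `|x| > A` one has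
`∫ M(y,x)² f(y) dy ≤ C·exp(−2γ|x|)`; equivalently,
`4 f(x)² ∫ (1_{y>x} − F(y))²/f(y) dy ≤ C·exp(−2γ|x|)`. -/
theorem stmt_13
    (S : ℝ → ℝ) (hS : Continuous S)
    (A γ : ℝ) (hA : 0 < A) (hγ : 0 < γ)
    (hSr : ∀ x, A < x → S x ≤ -γ)
    (hSl : ∀ x, x < -A → γ ≤ S x)
    (B : ℝ → ℝ) (hB : ∀ x, B x = 2 * ∫ y in (0:ℝ)..x, S y)
    (G : ℝ) (hG : G = ∫ y : ℝ, Real.exp (B y))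
    (f : ℝ → ℝ) (hf : ∀ x, f x = Real.exp (B x) / G)
    (F : ℝ → ℝ) (hF : ∀ x, F x = ∫ y in Set.Iic x, f y)
    (M : ℝ → ℝ → ℝ)
    (hM : ∀ y x, M y x = 2 * f x * ((if x < y then (1:ℝ) else 0) - F y) / f y) :
    ∃ C > (0:ℝ), ∀ x : ℝ, A < |x| →
      (∫ y : ℝ, (M y x) ^ 2 * f y) ≤ C * Real.exp (-2 * γ * |x|) ∧
      4 * f x ^ 2 * (∫ y : ℝ, ((if x < y then (1:ℝ) else 0) - F y) ^ 2 / f y) ≤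
        C * Real.exp (-2 * γ * |x|) := by
  have hII : ∀ a b, IntervalIntegrable S volume a b := fun a b => hS.intervalIntegrable a b
  have hBd : ∀ x y, B x - B y = 2 * ∫ t in y..x, S t := by
    intro x y
    rw [hB, hB, ← mul_sub, intervalIntegral.integral_interval_sub_left (hII _ _) (hII _ _)]
  have hBc : Continuous B := by
    have : B = fun x => 2 * ∫ y in (0:ℝ)..x, S y := funext hB
    rw [this]
    exact continuous_const.mul (intervalIntegral.continuous_primitive hII 0)
  have hBr : ∀ x y, A ≤ y → y ≤ x → B x ≤ B y + -2 * γ * |x - y| := by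
    intro x y hy hxy
    have := intervalIntegral.integral_mono_on_of_le_Ioo hxy (hII y x)
      (intervalIntegrable_const (c := -γ)) (fun t ht => hSr t (lt_of_le_of_lt hy ht.1))
    rw [intervalIntegral.integral_const, smul_eq_mul] at this
    rw [abs_of_nonneg (by linarith)]
    have := hBd x y
    nlinarith
  have hBl : ∀ x y, y ≤ -A → x ≤ y → B x ≤ B y + -2 * γ * |x - y| := by
    intro x y hy hxy
    have := intervalIntegral.integral_mono_on_of_le_Ioo hxy
      (intervalIntegrable_const (c := γ)) (hII x y)
      (fun t ht => hSl t (lt_of_lt_of_le ht.2 hy))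
    rw [intervalIntegral.integral_const, smul_eq_mul] at this
    rw [abs_of_nonpos (by linarith)]
    have := hBd y x
    nlinarith
  -- bounds on the compact interval
  obtain ⟨D, hD⟩ : ∃ D, ∀ t ∈ Set.Icc (-A) A, |B t| ≤ D := by
    obtain ⟨D, hD⟩ := isCompact_Icc.exists_bound_of_continuousOn
      (s := Set.Icc (-A) A) hBc.continuousOn
    exact ⟨D, fun t ht => hD t ht⟩
  have hBall : ∀ x, B x ≤ D + 2 * γ * A + -2 * γ * |x| := by
    intro x
    have hDA := (abs_le.1 (hD A ⟨by linarith, le_rfl⟩)).2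
    have hDA' := (abs_le.1 (hD (-A) ⟨le_rfl, by linarith⟩)).2
    rcases le_total A x with h | h
    · have := hBr x A le_rfl h
      rw [abs_of_nonneg (by linarith)] at this
      rw [abs_of_nonneg (by linarith)]
      nlinarith
    · rcases le_total x (-A) with h' | h'
      · have := hBl x (-A) le_rfl h'
        rw [abs_of_nonpos (by linarith)] at this
        rw [abs_of_nonpos (by linarith)]
        nlinarith
      · have := (abs_le.1 (hD x ⟨h', h⟩)).2
        have h3 : |x| ≤ A := abs_le.2 ⟨h', h⟩
        nlinarith
  have hE := aux_exp_abs_integrable γ hγ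
  have hexpI : Integrable (fun y => Real.exp (B y)) := by
    refine (hE.const_mul (Real.exp (D + 2 * γ * A))).mono'
      (Real.continuous_exp.comp hBc).aestronglyMeasurable (Filter.Eventually.of_forall fun x => ?_)
    rw [Real.norm_eq_abs, abs_of_pos (Real.exp_pos _), ← Real.exp_add]
    exact Real.exp_le_exp.2 (hBall x)
  have hGpos : 0 < G := by
    rw [hG]
    exact integral_exp_pos hexpI
  have hfpos : ∀ x, 0 < f x := fun x => by rw [hf]; exact div_pos (Real.exp_pos _) hGpos
  have hfe : f = fun x => Real.exp (B x) / G := funext hf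
  have hfI : Integrable f := by rw [hfe]; exact hexpI.div_const G
  have hf1 : ∫ y, f y = 1 := by
    rw [hfe, integral_div, ← hG, div_self hGpos.ne']
  have hfcmp : ∀ x y, B x ≤ B y + -2 * γ * |x - y| →
      f x ≤ f y * Real.exp (-2 * γ * |x - y|) := by
    intro x y h
    rw [hf, hf, div_mul_eq_mul_div, ← Real.exp_add]
    exact div_le_div_of_nonneg_right (Real.exp_le_exp.2 h) hGpos.le
  obtain ⟨L, hL0, hL⟩ : ∃ L > 0, ∀ x, f x ≤ L * Real.exp (-2 * γ * |x|) := by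
    refine ⟨Real.exp (D + 2 * γ * A) / G, div_pos (Real.exp_pos _) hGpos, fun x => ?_⟩
    rw [hf, div_mul_eq_mul_div, ← Real.exp_add]
    exact div_le_div_of_nonneg_right (Real.exp_le_exp.2 (hBall x)) hGpos.le
  have hL' : ∀ x, f x ≤ L := by
    intro x
    refine (hL x).trans (mul_le_of_le_one_right hL0.le (Real.exp_le_one_iff.2 ?_))
    have := mul_nonneg hγ.le (abs_nonneg x)
    linarith
  have hm : ∀ t, -A ≤ t → t ≤ A → 1 ≤ G * Real.exp D * f t := by
    intro t h1 h2
    have := (abs_le.1 (hD t ⟨h1, h2⟩)).1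
    have h3 : G * Real.exp D * f t = Real.exp (D + B t) := by
      rw [hf, Real.exp_add]; field_simp
    rw [h3]
    exact Real.one_le_exp (by linarith)
  obtain ⟨J, hJ⟩ : ∃ J, J = ∫ t : ℝ, Real.exp (-2 * γ * |t|) := ⟨_, rfl⟩
  have hJ0 : 0 ≤ J := by rw [hJ]; exact integral_nonneg fun t => (Real.exp_pos _).le
  have hEx : ∀ x : ℝ, Integrable (fun t : ℝ => Real.exp (-2 * γ * |x - t|)) := fun x =>
    hE.comp_sub_left x
  have hJx : ∀ x : ℝ, ∫ t : ℝ, Real.exp (-2 * γ * |x - t|) = J := fun x => by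
    rw [hJ]; exact integral_sub_left_eq_self (fun t : ℝ => Real.exp (-2 * γ * |t|)) volume x
  have hFc : ∀ y, 1 - F y = ∫ t in Set.Ioi y, f t := by
    intro y
    have := intervalIntegral.integral_Iic_add_Ioi (b := y) hfI.integrableOn hfI.integrableOn
    rw [hF, ← hf1, ← this]; ring
  have hF0 : ∀ y, 0 ≤ F y := fun y => by
    rw [hF]; exact integral_nonneg fun t => (hfpos t).le
  have hF1 : ∀ y, 0 ≤ 1 - F y := fun y => by
    rw [hFc]; exact integral_nonneg fun t => (hfpos t).le
  have htail : ∀ (s : Set ℝ) (y : ℝ), MeasurableSet s →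
      (∀ t ∈ s, f t ≤ f y * Real.exp (-2 * γ * |t - y|)) → ∫ t in s, f t ≤ J * f y := by
    intro s y hs h
    have hI : Integrable (fun t : ℝ => f y * Real.exp (-2 * γ * |y - t|)) :=
      (hEx y).const_mul _
    calc ∫ t in s, f t ≤ ∫ t in s, f y * Real.exp (-2 * γ * |y - t|) := by
          refine setIntegral_mono_on hfI.integrableOn hI.integrableOn hs fun t ht => ?_
          rw [abs_sub_comm]; exact h t ht
      _ ≤ ∫ t, f y * Real.exp (-2 * γ * |y - t|) :=
          setIntegral_le_integral hI (Filter.Eventually.of_forall fun t =>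
            mul_nonneg (hfpos y).le (Real.exp_pos _).le)
      _ = J * f y := by rw [integral_const_mul, hJx]; ring
  obtain ⟨K, hK⟩ : ∃ K, K = J + G * Real.exp D := ⟨_, rfl⟩
  have hGD : 0 < G * Real.exp D := mul_pos hGpos (Real.exp_pos _)
  have hFK : ∀ y, y ≤ A → F y ≤ K * f y := by
    intro y hy
    have hp := hfpos y
    rcases le_total y (-A) with h | h
    · have := htail (Set.Iic y) y measurableSet_Iic
        fun t ht => hfcmp t y (hBl t y h ht)
      rw [← hF] at this
      rw [hK]; nlinarith [mul_pos hGD hp]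
    · have := hm y h hy
      have := hF1 y
      rw [hK]; nlinarith [mul_nonneg hJ0 hp.le]
  have hFK' : ∀ y, -A ≤ y → 1 - F y ≤ K * f y := by
    intro y hy
    have hp := hfpos y
    rcases le_total A y with h | h
    · have := htail (Set.Ioi y) y measurableSet_Ioi
        fun t ht => hfcmp t y (hBr t y h (le_of_lt ht))
      rw [← hFc] at this
      rw [hK]; nlinarith [mul_pos hGD hp]
    · have := hm y hy h
      have := hF0 y
      rw [hK]; nlinarith [mul_nonneg hJ0 hp.le]
  have hpt : ∀ x, A < |x| → ∀ y,
      4 * f x ^ 2 * (((if x < y then (1:ℝ) else 0) - F y) ^ 2 / f y) ≤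
        4 * f x * (L * K ^ 2 * f y + Real.exp (-2 * γ * |x - y|)) := by
    intro x hx y
    have hx0 := hfpos x
    have hy0 := hfpos y
    have hadd1 : 4 * f x * (L * K ^ 2 * f y) ≤
        4 * f x * (L * K ^ 2 * f y + Real.exp (-2 * γ * |x - y|)) := by
      have := Real.exp_pos (-2 * γ * |x - y|)
      gcongr; linarith
    have hadd2 : 4 * f x * Real.exp (-2 * γ * |x - y|) ≤
        4 * f x * (L * K ^ 2 * f y + Real.exp (-2 * γ * |x - y|)) := by
      have : 0 ≤ L * K ^ 2 * f y := by positivity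
      gcongr; linarith
    rcases lt_abs.1 hx with hx | hx
    · split_ifs with hxy
      · exact (aux_alg1 hx0 hy0 (hF1 y) (hFK' y (by linarith)) (hL' x)).trans hadd1
      · rw [zero_sub, neg_sq]
        push Not at hxy
        rcases le_total y A with h | h
        · exact (aux_alg1 hx0 hy0 (hF0 y) (hFK y h) (hL' x)).trans hadd1
        · exact (aux_alg2 hx0 hy0 (hF0 y) (by linarith [hF1 y])
            (hfcmp x y (hBr x y h hxy))).trans hadd2
    · split_ifs with hxy
      · rcases le_total y (-A) with h | h
        · exact (aux_alg2 hx0 hy0 (hF1 y) (by linarith [hF0 y])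
            (hfcmp x y (hBl x y h hxy.le))).trans hadd2
        · exact (aux_alg1 hx0 hy0 (hF1 y) (hFK' y h) (hL' x)).trans hadd1
      · rw [zero_sub, neg_sq]
        push Not at hxy
        exact (aux_alg1 hx0 hy0 (hF0 y) (hFK y (by linarith)) (hL' x)).trans hadd1
  have hmain : ∀ x, A < |x| →
      4 * f x ^ 2 * (∫ y : ℝ, ((if x < y then (1:ℝ) else 0) - F y) ^ 2 / f y) ≤
        4 * L * (L * K ^ 2 + J + 1) * Real.exp (-2 * γ * |x|) := by
    intro x hx
    rw [← integral_const_mul]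
    have hI1 : Integrable (fun y => L * K ^ 2 * f y) := hfI.const_mul _
    have := integral_mono_of_nonneg (μ := volume)
      (f := fun y => 4 * f x ^ 2 * (((if x < y then (1:ℝ) else 0) - F y) ^ 2 / f y))
      (g := fun y => 4 * f x * (L * K ^ 2 * f y + Real.exp (-2 * γ * |x - y|)))
      (Filter.Eventually.of_forall fun y => by
        have := hfpos y
        simp only [Pi.zero_apply]
        positivity)
      ((hI1.add (hEx x)).const_mul _) (Filter.Eventually.of_forall (hpt x hx))
    refine this.trans ?_
    rw [integral_const_mul, integral_add hI1 (hEx x), integral_const_mul, hf1, hJx, mul_one]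
    have hk : 0 ≤ L * K ^ 2 := by positivity
    calc 4 * f x * (L * K ^ 2 + J)
        ≤ 4 * (L * Real.exp (-2 * γ * |x|)) * (L * K ^ 2 + J + 1) := by
          have := hL x
          have := hfpos x
          exact mul_le_mul (by linarith) (by linarith) (by linarith) (by linarith)
      _ = _ := by ring
  refine ⟨4 * L * (L * K ^ 2 + J + 1), by positivity, fun x hx => ⟨?_, hmain x hx⟩⟩
  refine le_trans (le_of_eq ?_) (hmain x hx)
  rw [← integral_const_mul]
  refine integral_congr_ae (Filter.Eventually.of_forall fun y => ?_)
  have := (hfpos y).ne'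
  simp only [hM]
  field_simp
  ring
end

section
/- For every L > 0 there exists a constant C > 0 such that for all x, y ∈ [−L, L] one has ∫_ℝ ( M(z,x) − M(z,y) )² f(z) dz ≤ C·|x − y|. -/
open MeasureTheory

lemma tail_aux (b : ℝ → ℝ) (hb : Continuous b) (A g : ℝ) (hg : 0 < g)
    (h : ∀ z w, A ≤ z → z ≤ w → b w - b z ≤ -g * (w - z)) (z : ℝ) (hz : A ≤ z) :
    IntegrableOn (fun w => Real.exp (b w)) (Set.Ioi z) ∧
      ∫ w in Set.Ioi z, Real.exp (b w) ≤ Real.exp (b z) / g := by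
  have hle : ∀ w ∈ Set.Ioi z, Real.exp (b w) ≤ Real.exp (b z + g * z) * Real.exp (-g * w) := by
    intro w hw
    rw [← Real.exp_add]
    apply Real.exp_le_exp.2
    have := h z w hz (le_of_lt hw)
    nlinarith
  have hi : IntegrableOn (fun w => Real.exp (b z + g * z) * Real.exp (-g * w)) (Set.Ioi z) :=
    (integrableOn_exp_mul_Ioi (by linarith : -g < 0) z).const_mul _
  have hi2 : IntegrableOn (fun w => Real.exp (b w)) (Set.Ioi z) := by
    refine Integrable.mono' hi (Continuous.aestronglyMeasurable (by fun_prop)) ?_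
    refine (ae_restrict_iff' measurableSet_Ioi).2 (Filter.Eventually.of_forall ?_)
    intro w hw
    rw [Real.norm_of_nonneg (Real.exp_pos _).le]
    exact hle w hw
  refine ⟨hi2, ?_⟩
  refine (setIntegral_mono_on hi2 hi measurableSet_Ioi hle).trans (le_of_eq ?_)
  rw [integral_const_mul, integral_exp_mul_Ioi (by linarith : -g < 0) z, neg_div_neg_eq,
    ← mul_div_assoc, ← Real.exp_add]
  congr 2
  ring

lemma mean_aux (B S : ℝ → ℝ) (hd : ∀ x, HasDerivAt B (2 * S x) x) (A γ : ℝ)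
    (hSr : ∀ x, A < x → S x ≤ -γ) :
    ∀ z w, A ≤ z → z ≤ w → B w - B z ≤ -(2 * γ) * (w - z) := by
  intro z w hz hw
  refine Convex.image_sub_le_mul_sub_of_deriv_le (convex_Ici A)
    (fun x _ => (hd x).continuousAt.continuousWithinAt)
    (fun x _ => (hd x).differentiableAt.differentiableWithinAt) ?_ z hz w (hz.trans hw) hw
  intro x hx
  rw [interior_Ici] at hx
  rw [(hd x).deriv]
  linarith [hSr x hx]

lemma tails (S : ℝ → ℝ) (hS : Continuous S)
    (A γ : ℝ) (hγ : 0 < γ)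
    (hSr : ∀ x, A < x → S x ≤ -γ)
    (hSl : ∀ x, x < -A → γ ≤ S x)
    (B : ℝ → ℝ) (hd : ∀ x, HasDerivAt B (2 * S x) x) :
    Integrable (fun w => Real.exp (B w)) ∧
    (∀ z, A ≤ z → ∫ w in Set.Ioi z, Real.exp (B w) ≤ Real.exp (B z) / (2 * γ)) ∧
    (∀ z, z ≤ -A → ∫ w in Set.Iic z, Real.exp (B w) ≤ Real.exp (B z) / (2 * γ)) := by
  have hBc : Continuous B := continuous_iff_continuousAt.2 fun x => (hd x).continuousAt
  have h1 := tail_aux B hBc A (2 * γ) (by linarith) (mean_aux B S hd A γ hSr)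
  have hd' : ∀ x, HasDerivAt (fun x => B (-x)) (2 * (-S (-x))) x := by
    intro x
    have := (hd (-x)).comp x (hasDerivAt_neg x)
    exact this.congr_deriv (by ring)
  have h2 := tail_aux (fun x => B (-x)) (by fun_prop) A (2 * γ) (by linarith)
    (mean_aux (fun x => B (-x)) (fun x => -S (-x)) hd' A γ
      (fun x hx => by have := hSl (-x) (by linarith); linarith))
  refine ⟨?_, fun z hz => (h1 z hz).2, ?_⟩
  · have i1 := (h1 A le_rfl).1
    have i2 : IntegrableOn (fun w => Real.exp (B w)) (Set.Iio (-A)) := by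
      have := (h2 A le_rfl).1.comp_neg
      simpa using this
    have i3 : IntegrableOn (fun w => Real.exp (B w)) (Set.Icc (-A) A) :=
      (Continuous.continuousOn (by fun_prop)).integrableOn_Icc
    rw [← integrableOn_univ]
    refine ((i1.union i2).union i3).mono_set ?_
    intro x _
    by_cases h : A < x
    · exact Or.inl (Or.inl h)
    by_cases h' : x < -A
    · exact Or.inl (Or.inr h')
    exact Or.inr ⟨not_lt.1 h', not_lt.1 h⟩
  · intro z hz
    have := (h2 (-z) (by linarith)).2
    rw [integral_comp_neg_Ioi (-z) (fun w => Real.exp (B w))] at this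
    simpa using this

/-- For every `L > 0` there is `C > 0` such that for all `x, y ∈ [−L, L]`,
`∫ ( M(z,x) − M(z,y) )² f(z) dz ≤ C·|x − y|`. -/
theorem stmt_14
    (S : ℝ → ℝ) (hS : Continuous S)
    (A γ : ℝ) (hA : 0 < A) (hγ : 0 < γ)
    (hSr : ∀ x, A < x → S x ≤ -γ)
    (hSl : ∀ x, x < -A → γ ≤ S x)
    (B : ℝ → ℝ) (hB : ∀ x, B x = 2 * ∫ y in (0:ℝ)..x, S y)
    (G : ℝ) (hG : G = ∫ y : ℝ, Real.exp (B y))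
    (f : ℝ → ℝ) (hf : ∀ x, f x = Real.exp (B x) / G)
    (F : ℝ → ℝ) (hF : ∀ x, F x = ∫ y in Set.Iic x, f y)
    (M : ℝ → ℝ → ℝ)
    (hM : ∀ y x, M y x = 2 * f x * ((if x < y then (1:ℝ) else 0) - F y) / f y) :
    ∀ L > (0:ℝ), ∃ C > (0:ℝ), ∀ x ∈ Set.Icc (-L) L, ∀ y ∈ Set.Icc (-L) L,
      (∫ z : ℝ, (M z x - M z y) ^ 2 * f z) ≤ C * |x - y| := by
  intro L hL
  have hd : ∀ x, HasDerivAt B (2 * S x) x := by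
    intro x
    have : HasDerivAt (fun x => 2 * ∫ y in (0:ℝ)..x, S y) (2 * S x) x :=
      (intervalIntegral.integral_hasDerivAt_right (hS.intervalIntegrable _ _)
        hS.stronglyMeasurable.stronglyMeasurableAtFilter hS.continuousAt).const_mul 2
    rwa [← funext hB] at this
  have hBc : Continuous B := continuous_iff_continuousAt.2 fun x => (hd x).continuousAt
  obtain ⟨hint, hT1, hT2⟩ := tails S hS A γ hγ hSr hSl B hd
  have hGpos : 0 < G := by rw [hG]; exact integral_exp_pos hint
  have hfe : f = fun x => Real.exp (B x) / G := funext hf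
  have hfpos : ∀ x, 0 < f x := fun x => by rw [hf]; positivity
  have hfc : Continuous f := by rw [hfe]; fun_prop
  have hfi : Integrable f := by rw [hfe]; exact hint.div_const G
  have hf1 : ∫ x, f x = 1 := by
    rw [hfe, integral_div, ← hG, div_self hGpos.ne']
  have hfd : ∀ x, HasDerivAt f (2 * S x * f x) x := by
    intro x
    have := ((hd x).exp).div_const G
    rw [hfe]
    exact this.congr_deriv (by ring)
  have hF0 : ∀ z, 0 ≤ F z := fun z => by
    rw [hF]; exact setIntegral_nonneg measurableSet_Iic fun x _ => (hfpos x).le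
  have hF1' : ∀ z, 1 - F z = ∫ w in Set.Ioi z, f w := fun z => by
    have := intervalIntegral.integral_Iic_add_Ioi (b := z) hfi.integrableOn hfi.integrableOn
    rw [hF, ← hf1, ← this]; ring
  have hF1 : ∀ z, 0 ≤ 1 - F z := fun z => by
    rw [hF1']; exact setIntegral_nonneg measurableSet_Ioi fun x _ => (hfpos x).le
  set R := A + L with hR
  obtain ⟨m, hm, hmf⟩ : ∃ m > 0, ∀ z ∈ Set.Icc (-R) R, m ≤ f z := by
    obtain ⟨c, _, hc⟩ := (isCompact_Icc (a := -R) (b := R)).exists_isMinOn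
      (Set.nonempty_Icc.2 (by linarith)) hfc.continuousOn
    exact ⟨f c, hfpos c, fun z hz => hc hz⟩
  obtain ⟨K, hKf⟩ := (isCompact_Icc (a := -R) (b := R)).exists_bound_of_continuousOn
    hfc.continuousOn
  obtain ⟨Λ, hΛ⟩ := (isCompact_Icc (a := -R) (b := R)).exists_bound_of_continuousOn
    (f := fun x => 2 * S x * f x) (Continuous.continuousOn (by fun_prop))
  have hlip : ∀ x ∈ Set.Icc (-R) R, ∀ y ∈ Set.Icc (-R) R, |f x - f y| ≤ Λ * |x - y| := by
    intro x hx y hy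
    exact (convex_Icc (-R) R).norm_image_sub_le_of_norm_hasDerivWithin_le
      (fun z _ => (hfd z).hasDerivWithinAt) hΛ hy hx
  obtain ⟨P, hP, hP1, hP2⟩ : ∃ P > 0, (∀ z, -R ≤ z → 1 - F z ≤ P * f z) ∧
      (∀ z, z ≤ R → F z ≤ P * f z) := by
    refine ⟨1 / (2 * γ) + 1 / m, by positivity, ?_, ?_⟩
    · intro z hz
      rw [add_mul]
      have hp1 : 0 ≤ 1 / (2 * γ) * f z := by have := hfpos z; positivity
      have hp2 : 0 ≤ 1 / m * f z := by have := hfpos z; positivity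
      by_cases h : A ≤ z
      · have : 1 - F z ≤ 1 / (2 * γ) * f z := by
          rw [hF1', hfe]
          simp only
          rw [integral_div]
          calc _ ≤ (Real.exp (B z) / (2 * γ)) / G := by gcongr; exact hT1 z h
            _ = _ := by ring
        linarith
      · have h1 : 1 ≤ 1 / m * f z := by
          rw [one_div, ← div_eq_inv_mul, one_le_div hm]
          exact hmf z ⟨hz, by linarith⟩
        linarith [hF0 z]
    · intro z hz
      rw [add_mul]
      have hp1 : 0 ≤ 1 / (2 * γ) * f z := by have := hfpos z; positivity
      have hp2 : 0 ≤ 1 / m * f z := by have := hfpos z; positivity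
      by_cases h : z ≤ -A
      · have : F z ≤ 1 / (2 * γ) * f z := by
          rw [hF, hfe]
          simp only
          rw [integral_div]
          calc _ ≤ (Real.exp (B z) / (2 * γ)) / G := by gcongr; exact hT2 z h
            _ = _ := by ring
        linarith
      · have h1 : 1 ≤ 1 / m * f z := by
          rw [one_div, ← div_eq_inv_mul, one_le_div hm]
          exact hmf z ⟨by linarith, hz⟩
        linarith [hF1 z]
  have hK : ∀ z ∈ Set.Icc (-R) R, f z ≤ K := fun z hz => (le_abs_self _).trans (hKf z hz)
  have hKpos : 0 < K := (hfpos 0).trans_le (hK 0 ⟨by linarith, by linarith⟩)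
  have hsub : ∀ x ∈ Set.Icc (-L) L, x ∈ Set.Icc (-R) R := fun x hx =>
    ⟨by linarith [hx.1], by linarith [hx.2]⟩
  -- the pointwise bound, for ordered points
  have key : ∀ x ∈ Set.Icc (-L) L, ∀ y ∈ Set.Icc (-L) L, x ≤ y → ∀ z,
      (M z x - M z y) ^ 2 * f z ≤ (8 * Λ ^ 2 * L * P ^ 2 * |x - y|) * f z
        + (Set.Ioc x y).indicator (fun _ => 16 * K ^ 3 * P ^ 2) z := by
    intro x hx y hy hxy z
    have hfz := hfpos z
    have e : ∀ u v : ℝ, (M z x - M z y) = 2 * (f x * ((if x < z then (1:ℝ) else 0) - F z)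
        - f y * ((if y < z then (1:ℝ) else 0) - F z)) / f z := by
      intro _ _; rw [hM, hM]; ring
    rw [e 0 0]
    have hD : (f x - f y) ^ 2 ≤ Λ ^ 2 * (2 * L) * |x - y| := by
      have h1 := hlip x (hsub x hx) y (hsub y hy)
      have h2 : |x - y| ≤ 2 * L := by
        rw [abs_le]; constructor <;> linarith [hx.1, hx.2, hy.1, hy.2]
      have h0 := abs_nonneg (x - y)
      calc (f x - f y) ^ 2 = |f x - f y| ^ 2 := (sq_abs _).symm
        _ ≤ (Λ * |x - y|) ^ 2 := by gcongr
        _ = Λ ^ 2 * |x - y| * |x - y| := by ring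
        _ ≤ Λ ^ 2 * (2 * L) * |x - y| := by gcongr
    have gen : ∀ t : ℝ, 0 ≤ t → t ≤ P * f z → (2 * ((f x - f y) * t) / f z) ^ 2 * f z
        ≤ (8 * Λ ^ 2 * L * P ^ 2 * |x - y|) * f z := by
      intro t ht htP
      have e2 : (2 * ((f x - f y) * t) / f z) ^ 2 * f z
        = 4 * (f x - f y) ^ 2 * (t / f z) ^ 2 * f z := by ring
      have h3 : t / f z ≤ P := (div_le_iff₀ hfz).2 htP
      have h4 : 0 ≤ t / f z := by positivity
      rw [e2]
      calc 4 * (f x - f y) ^ 2 * (t / f z) ^ 2 * f z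
          ≤ 4 * (Λ ^ 2 * (2 * L) * |x - y|) * P ^ 2 * f z := by gcongr
        _ = _ := by ring
    by_cases h1 : x < z
    · by_cases h2 : y < z
      · have hn : z ∉ Set.Ioc x y := fun h => absurd h.2 (not_le.2 h2)
        rw [Set.indicator_of_notMem hn, add_zero, if_pos h1, if_pos h2, ← sub_mul]
        exact gen _ (hF1 z) (hP1 z (by linarith [hx.1]))
      · have hz : z ∈ Set.Ioc x y := ⟨h1, not_lt.1 h2⟩
        have hzR : z ∈ Set.Icc (-R) R := ⟨by linarith [hx.1], by linarith [hy.2, not_lt.1 h2]⟩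
        rw [Set.indicator_of_mem hz, if_pos h1, if_neg h2]
        have hb : 0 ≤ (8 * Λ ^ 2 * L * P ^ 2 * |x - y|) * f z := by positivity
        refine le_trans ?_ (le_add_of_nonneg_left hb)
        have a1 : (1 - F z) / f z ≤ P := (div_le_iff₀ hfz).2 (hP1 z hzR.1)
        have a2 : F z / f z ≤ P := (div_le_iff₀ hfz).2 (hP2 z hzR.2)
        have a3 : 0 ≤ (1 - F z) / f z := div_nonneg (hF1 z) hfz.le
        have a4 : 0 ≤ F z / f z := div_nonneg (hF0 z) hfz.le
        have kx := hK x (hsub x hx)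
        have ky := hK y (hsub y hy)
        have kz := hK z hzR
        have px := (hfpos x).le
        have py := (hfpos y).le
        calc (2 * (f x * (1 - F z) - f y * (0 - F z)) / f z) ^ 2 * f z
            = (2 * (f x * ((1 - F z) / f z) + f y * (F z / f z))) ^ 2 * f z := by ring
          _ ≤ (2 * (K * P + K * P)) ^ 2 * K := by gcongr
          _ = _ := by ring
    · have h2 : ¬ y < z := by linarith
      have hn : z ∉ Set.Ioc x y := fun h => h1 h.1
      rw [Set.indicator_of_notMem hn, add_zero, if_neg h1, if_neg h2]
      have := gen _ (hF0 z) (hP2 z (by linarith [hx.2]))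
      calc _ = (2 * ((f x - f y) * F z) / f z) ^ 2 * f z := by ring
        _ ≤ _ := this
  have main : ∀ x ∈ Set.Icc (-L) L, ∀ y ∈ Set.Icc (-L) L, x ≤ y →
      (∫ z : ℝ, (M z x - M z y) ^ 2 * f z)
        ≤ (8 * Λ ^ 2 * L * P ^ 2 + 16 * K ^ 3 * P ^ 2) * |x - y| := by
    intro x hx y hy hxy
    have j1 : Integrable (fun z => (8 * Λ ^ 2 * L * P ^ 2 * |x - y|) * f z) := hfi.const_mul _
    have j2 : Integrable ((Set.Ioc x y).indicator (fun _ : ℝ => 16 * K ^ 3 * P ^ 2)) :=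
      (integrable_indicator_iff measurableSet_Ioc).2 (integrableOn_const (by simp))
    refine (integral_mono_of_nonneg (Filter.Eventually.of_forall fun z => ?_) (j1.add j2)
      (Filter.Eventually.of_forall fun z => key x hx y hy hxy z)).trans (le_of_eq ?_)
    · exact mul_nonneg (sq_nonneg _) (hfpos z).le
    · simp only [Pi.add_apply]
      rw [integral_add j1 j2, integral_const_mul, hf1, integral_indicator measurableSet_Ioc,
        setIntegral_const, Real.volume_real_Ioc_of_le hxy, abs_sub_comm x y,
        abs_of_nonneg (sub_nonneg.2 hxy), smul_eq_mul]
      ring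
  refine ⟨8 * Λ ^ 2 * L * P ^ 2 + 16 * K ^ 3 * P ^ 2, by positivity, ?_⟩
  intro x hx y hy
  rcases le_total x y with h | h
  · exact main x hx y hy h
  · have := main y hy x hx h
    rw [abs_sub_comm x y]
    refine le_trans (le_of_eq ?_) this
    congr 1
    funext z
    ring
end

section
/- There exists a constant C > 0 such that for all x with |x| > A one has ∫_ℝ H(z,x)² f(z) dz ≤ C·exp(−γ|x|). -/
open MeasureTheory

lemma aux_exp_int (k : ℝ) (hk : 0 < k) : Integrable (fun y : ℝ => Real.exp (-k * |y|)) := by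
  have h1 : IntegrableOn (fun y : ℝ => Real.exp (-k * |y|)) (Set.Ioi 0) := by
    refine (exp_neg_integrableOn_Ioi 0 hk).congr_fun ?_ measurableSet_Ioi
    intro y hy
    simp only [abs_of_pos (Set.mem_Ioi.1 hy)]
  have h2 : IntegrableOn (fun y : ℝ => Real.exp (-k * |y|)) (Set.Iic 0) := by
    refine (integrableOn_exp_mul_Iic hk 0).congr_fun ?_ measurableSet_Iic
    intro y hy
    simp only [abs_of_nonpos (Set.mem_Iic.1 hy)]
    ring_nf
  have := h2.union h1
  rwa [Set.Iic_union_Ioi, integrableOn_univ] at this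

lemma aux_core_s16 (f F : ℝ → ℝ) (A k : ℝ) (hA : 0 < A) (hk : 0 < k) (hfc : Continuous f)
    (hpos : ∀ x, 0 < f x) (hint : Integrable f) (h1 : ∫ x, f x = 1)
    (hr : ∀ x y, A ≤ x → x ≤ y → f y ≤ f x * Real.exp (-k * |x - y|))
    (hl : ∀ x y, y ≤ x → x ≤ -A → f y ≤ f x * Real.exp (-k * |x - y|))
    (hF : ∀ x, F x = ∫ y in Set.Iic x, f y) :
    ∃ C > (0:ℝ), ∀ x : ℝ, A < x →
      (∫ z : ℝ, (2 * (F (min z x) - F z * F x) / f z) ^ 2 * f z)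
        ≤ C * Real.exp (-k * |x|) := by
  obtain ⟨J, hJ⟩ : ∃ J, J = ∫ y : ℝ, Real.exp (-k * |y|) := ⟨_, rfl⟩
  have hJ0 : 0 ≤ J := by rw [hJ]; exact integral_nonneg fun y => (Real.exp_pos _).le
  have hei : ∀ x : ℝ, Integrable (fun y : ℝ => Real.exp (-k * |x - y|)) := fun x =>
    (aux_exp_int k hk).comp_sub_left x
  have hej : ∀ x : ℝ, ∫ y : ℝ, Real.exp (-k * |x - y|) = J := fun x => by
    rw [hJ]; exact integral_sub_left_eq_self (fun y : ℝ => Real.exp (-k * |y|)) volume x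
  have tail : ∀ x (s : Set ℝ), MeasurableSet s → (∀ y ∈ s, f y ≤ f x * Real.exp (-k * |x - y|)) →
      ∫ y in s, f y ≤ J * f x := by
    intro x s hs h
    calc ∫ y in s, f y ≤ ∫ y in s, f x * Real.exp (-k * |x - y|) :=
          setIntegral_mono_on hint.integrableOn ((hei x).const_mul _).integrableOn hs h
      _ ≤ ∫ y, f x * Real.exp (-k * |x - y|) :=
          setIntegral_le_integral ((hei x).const_mul _)
            (Filter.Eventually.of_forall fun y => mul_nonneg (hpos x).le (Real.exp_pos _).le)
      _ = J * f x := by rw [integral_const_mul, hej]; ring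
  have hcompl : ∀ x, 1 - F x = ∫ y in Set.Ioi x, f y := by
    intro x
    rw [hF, ← h1, ← integral_add_compl (measurableSet_Iic (a := x)) hint, Set.compl_Iic]
    ring
  have hF0 : ∀ x, 0 ≤ F x := fun x => by
    rw [hF]; exact integral_nonneg fun y => (hpos y).le
  have hF1 : ∀ x, 0 ≤ 1 - F x := fun x => by
    rw [hcompl]; exact integral_nonneg fun y => (hpos y).le
  have hT : ∀ x, A ≤ x → 1 - F x ≤ J * f x := fun x hx => by
    rw [hcompl]
    exact tail x _ measurableSet_Ioi fun y hy => hr x y hx (le_of_lt hy)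
  obtain ⟨c, hc0, hc⟩ : ∃ c, 0 ≤ c ∧ ∀ z, z ≤ A → F z ≤ c * f z := by
    obtain ⟨w, hw, hmin⟩ := (isCompact_Icc (a := -A) (b := A)).exists_isMinOn
      ⟨0, by constructor <;> linarith⟩ hfc.continuousOn
    have hw0 := hpos w
    refine ⟨J + 1 / f w, by positivity, fun z hz => ?_⟩
    rcases le_total z (-A) with h | h
    · have : F z ≤ J * f z := by
        rw [hF]; exact tail z _ measurableSet_Iic fun y hy => hl z y hy h
      have h2 : 0 ≤ 1 / f w * f z := mul_nonneg (by positivity) (hpos z).le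
      linarith [add_mul J (1 / f w) (f z)]
    · have h3 : f w ≤ f z := hmin ⟨h, hz⟩
      have h4 : 1 ≤ 1 / f w * f z := by
        rw [one_div_mul_eq_div, le_div_iff₀ hw0]; linarith
      have h5 : 0 ≤ J * f z := mul_nonneg hJ0 (hpos z).le
      linarith [add_mul J (1 / f w) (f z), hF1 z]
  have hfA := hpos A
  obtain ⟨M, hM0, hM⟩ : ∃ M, 0 < M ∧ ∀ x, A < x → f x ≤ M * Real.exp (-k * |x|) := by
    refine ⟨f A * Real.exp (k * A), by positivity, fun x hx => ?_⟩
    refine (hr A x le_rfl hx.le).trans (le_of_eq ?_)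
    rw [mul_assoc, ← Real.exp_add, abs_of_nonpos (by linarith), abs_of_pos (by linarith)]
    ring_nf
  refine ⟨(4 * c ^ 2 * J ^ 2 * M + 4 * (J ^ 2 + J ^ 2) * J) * M + 1, by positivity, fun x hx => ?_⟩
  have hfx := hpos x
  have key : (∫ z : ℝ, (2 * (F (min z x) - F z * F x) / f z) ^ 2 * f z) ≤
      ∫ z : ℝ, (4 * c ^ 2 * J ^ 2 * f x ^ 2 * f z
        + 4 * (J ^ 2 + J ^ 2) * f x * Real.exp (-k * |x - z|)) := by
    refine integral_mono_of_nonneg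
      (Filter.Eventually.of_forall fun z => mul_nonneg (sq_nonneg _) (hpos z).le)
      ((hint.const_mul _).add ((hei x).const_mul _)) (Filter.Eventually.of_forall fun z => ?_)
    have hfz := hpos z
    have hE := Real.exp_pos (-k * |x - z|)
    have e1 : (2 * (F (min z x) - F z * F x) / f z) ^ 2 * f z
        = 4 * (F (min z x) - F z * F x) ^ 2 / f z := by field_simp; ring
    simp only [e1]
    rw [div_le_iff₀ hfz]
    have tx := hT x hx.le
    rcases le_total z x with hzx | hzx
    · rw [min_eq_left hzx]
      have e2 : F z - F z * F x = F z * (1 - F x) := by ring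
      rw [e2]
      rcases le_total z A with hz | hz
      · have b1 : F z * (1 - F x) ≤ (c * f z) * (J * f x) :=
          mul_le_mul (hc z hz) tx (hF1 x) (by positivity)
        have b2 := pow_le_pow_left₀ (mul_nonneg (hF0 z) (hF1 x)) b1 2
        have : 0 ≤ 4 * (J ^ 2 + J ^ 2) * f x * Real.exp (-k * |x - z|) * f z := by positivity
        nlinarith
      · have b1 : F z * (1 - F x) ≤ 1 * (J * f x) :=
          mul_le_mul (by linarith [hF1 z]) tx (hF1 x) (by positivity)
        have b2 := pow_le_pow_left₀ (mul_nonneg (hF0 z) (hF1 x)) b1 2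
        have b3 := hr z x hz hzx
        rw [abs_sub_comm] at b3
        have b4 : 4 * J ^ 2 * f x * f x ≤ 4 * J ^ 2 * f x * (f z * Real.exp (-k * |x - z|)) :=
          mul_le_mul_of_nonneg_left b3 (by positivity)
        have p1 : 0 ≤ 4 * J ^ 2 * f x * Real.exp (-k * |x - z|) * f z := by positivity
        have p2 : 0 ≤ 4 * c ^ 2 * J ^ 2 * f x ^ 2 * f z * f z := by positivity
        nlinarith
    · rw [min_eq_right hzx]
      have e2 : F x - F z * F x = F x * (1 - F z) := by ring
      rw [e2]
      have b1 : F x * (1 - F z) ≤ 1 * (J * f z) :=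
        mul_le_mul (by linarith [hF1 x]) (hT z (by linarith)) (hF1 z) (by positivity)
      have b2 := pow_le_pow_left₀ (mul_nonneg (hF0 x) (hF1 z)) b1 2
      have b3 := hr x z hx.le hzx
      have b4 : 4 * J ^ 2 * f z * f z ≤ 4 * J ^ 2 * f z * (f x * Real.exp (-k * |x - z|)) :=
          mul_le_mul_of_nonneg_left b3 (by positivity)
      have p1 : 0 ≤ 4 * J ^ 2 * f x * Real.exp (-k * |x - z|) * f z := by positivity
      have p2 : 0 ≤ 4 * c ^ 2 * J ^ 2 * f x ^ 2 * f z * f z := by positivity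
      nlinarith
  rw [integral_add (hint.const_mul _) ((hei x).const_mul _), integral_const_mul,
    integral_const_mul, h1, hej] at key
  refine key.trans ?_
  have hE := Real.exp_pos (-k * |x|)
  have hx1 := hM x hx
  have hx2 : f x ≤ M := by
    refine hx1.trans (mul_le_of_le_one_right hM0.le ?_)
    rw [Real.exp_le_one_iff]
    have := mul_nonneg hk.le (abs_nonneg x)
    linarith
  calc _ = (4 * c ^ 2 * J ^ 2 * f x + 4 * (J ^ 2 + J ^ 2) * J) * f x := by ring
    _ ≤ (4 * c ^ 2 * J ^ 2 * M + 4 * (J ^ 2 + J ^ 2) * J) * (M * Real.exp (-k * |x|)) := by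
        gcongr
    _ ≤ _ := by linarith

lemma aux_int (E : ℝ → ℝ) (A k : ℝ) (hA : 0 < A) (hk : 0 < k) (hfc : Continuous E)
    (hpos : ∀ x, 0 < E x)
    (hr : ∀ x y, A ≤ x → x ≤ y → E y ≤ E x * Real.exp (-k * |x - y|))
    (hl : ∀ x y, y ≤ x → x ≤ -A → E y ≤ E x * Real.exp (-k * |x - y|)) : Integrable E := by
  have hei : ∀ x : ℝ, Integrable (fun y : ℝ => Real.exp (-k * |x - y|)) := fun x =>
    (aux_exp_int k hk).comp_sub_left x
  have i1 : IntegrableOn E (Set.Iic (-A)) := by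
    refine Integrable.mono' ((hei (-A)).const_mul (E (-A))).integrableOn
      hfc.aestronglyMeasurable ?_
    filter_upwards [ae_restrict_mem measurableSet_Iic] with y hy
    rw [Real.norm_of_nonneg (hpos y).le]
    exact hl _ y hy le_rfl
  have i2 : IntegrableOn E (Set.Icc (-A) A) := hfc.integrableOn_Icc
  have i3 : IntegrableOn E (Set.Ici A) := by
    refine Integrable.mono' ((hei A).const_mul (E A)).integrableOn
      hfc.aestronglyMeasurable ?_
    filter_upwards [ae_restrict_mem measurableSet_Ici] with y hy
    rw [Real.norm_of_nonneg (hpos y).le]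
    exact hr _ y le_rfl hy
  rw [← integrableOn_univ]
  refine ((i1.union i2).union i3).mono_set fun y _ => ?_
  rcases le_total y (-A) with h | h
  · exact Or.inl (Or.inl h)
  · rcases le_total y A with h' | h'
    · exact Or.inl (Or.inr ⟨h, h'⟩)
    · exact Or.inr h'

/-- There is `C > 0` such that for `|x| > A`,
`∫ H(z,x)² f(z) dz ≤ C·exp(−γ|x|)`. -/
theorem stmt_16
    (S : ℝ → ℝ) (hS : Continuous S)
    (A γ : ℝ) (hA : 0 < A) (hγ : 0 < γ)
    (hSr : ∀ x, A < x → S x ≤ -γ)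
    (hSl : ∀ x, x < -A → γ ≤ S x)
    (B : ℝ → ℝ) (hB : ∀ x, B x = 2 * ∫ y in (0:ℝ)..x, S y)
    (G : ℝ) (hG : G = ∫ y : ℝ, Real.exp (B y))
    (f : ℝ → ℝ) (hf : ∀ x, f x = Real.exp (B x) / G)
    (F : ℝ → ℝ) (hF : ∀ x, F x = ∫ y in Set.Iic x, f y)
    (H : ℝ → ℝ → ℝ)
    (hH : ∀ z x, H z x = 2 * (F (min z x) - F z * F x) / f z) :
    ∃ C > (0:ℝ), ∀ x : ℝ, A < |x| →
      (∫ z : ℝ, (H z x) ^ 2 * f z) ≤ C * Real.exp (-γ * |x|) := by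
  have hk : 0 < 2 * γ := by linarith
  have hSi : ∀ a b, IntervalIntegrable S volume a b := fun a b => hS.intervalIntegrable a b
  have hBd : ∀ x y, B y - B x = 2 * ∫ t in x..y, S t := by
    intro x y
    rw [hB, hB, ← mul_sub, intervalIntegral.integral_interval_sub_left (hSi _ _) (hSi _ _)]
  have hBc : Continuous B := by
    have : B = fun x => 2 * ∫ y in (0:ℝ)..x, S y := funext hB
    rw [this]
    exact continuous_const.mul (intervalIntegral.continuous_primitive hSi 0)
  have er : ∀ x y, A ≤ x → x ≤ y →
      Real.exp (B y) ≤ Real.exp (B x) * Real.exp (-(2 * γ) * |x - y|) := by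
    intro x y hx hxy
    rw [← Real.exp_add, Real.exp_le_exp, abs_of_nonpos (by linarith)]
    have h := intervalIntegral.integral_mono_on_of_le_Ioo hxy (hSi x y)
      (intervalIntegrable_const (c := -γ)) (fun t ht => hSr t (by linarith [ht.1]))
    rw [intervalIntegral.integral_const, smul_eq_mul] at h
    linarith [hBd x y]
  have el : ∀ x y, y ≤ x → x ≤ -A →
      Real.exp (B y) ≤ Real.exp (B x) * Real.exp (-(2 * γ) * |x - y|) := by
    intro x y hxy hx
    rw [← Real.exp_add, Real.exp_le_exp, abs_of_nonneg (by linarith)]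
    have h := intervalIntegral.integral_mono_on_of_le_Ioo hxy
      (intervalIntegrable_const (c := γ)) (hSi y x) (fun t ht => hSl t (by linarith [ht.2]))
    rw [intervalIntegral.integral_const, smul_eq_mul] at h
    linarith [hBd y x]
  have hEc : Continuous fun x => Real.exp (B x) := Real.continuous_exp.comp hBc
  have hEi : Integrable fun x => Real.exp (B x) :=
    aux_int _ A (2 * γ) hA hk hEc (fun x => Real.exp_pos _) er el
  have hG0 : 0 < G := by
    rw [hG]
    exact integral_exp_pos hEi
  have hff : f = fun x => Real.exp (B x) / G := funext hf
  have hfc : Continuous f := by rw [hff]; exact hEc.div_const G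
  have hfi : Integrable f := by rw [hff]; exact hEi.div_const G
  have hf1 : ∫ x, f x = 1 := by
    rw [hff, integral_div, ← hG, div_self hG0.ne']
  have hpos : ∀ x, 0 < f x := fun x => by rw [hf]; exact div_pos (Real.exp_pos _) hG0
  have fr : ∀ x y, A ≤ x → x ≤ y → f y ≤ f x * Real.exp (-(2 * γ) * |x - y|) := by
    intro x y h h'
    rw [hf, hf, div_mul_eq_mul_div]
    exact div_le_div_of_nonneg_right (er x y h h') hG0.le
  have fl : ∀ x y, y ≤ x → x ≤ -A → f y ≤ f x * Real.exp (-(2 * γ) * |x - y|) := by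
    intro x y h h'
    rw [hf, hf, div_mul_eq_mul_div]
    exact div_le_div_of_nonneg_right (el x y h h') hG0.le
  obtain ⟨C1, hC1, h1⟩ := aux_core_s16 f F A (2 * γ) hA hk hfc hpos hfi hf1 fr fl hF
  have hab : ∀ x y : ℝ, |x - y| = |-x - -y| := fun x y => by
    rw [← abs_neg]; ring_nf
  obtain ⟨C2, hC2, h2⟩ := aux_core_s16 (fun x => f (-x)) (fun x => 1 - F (-x)) A (2 * γ) hA hk
    (hfc.comp continuous_neg) (fun x => hpos _) hfi.comp_neg
    (by rw [integral_neg_eq_self (fun x => f x)]; exact hf1)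
    (fun x y h h' => by rw [hab]; exact fl _ _ (by linarith) (by linarith))
    (fun x y h h' => by rw [hab]; exact fr _ _ (by linarith) (by linarith))
    (fun x => by
      rw [integral_comp_neg_Iic x f, hF, ← hf1,
        ← integral_add_compl (measurableSet_Iic (a := -x)) hfi, Set.compl_Iic]
      ring)
  refine ⟨C1 + C2, by positivity, fun x hx => ?_⟩
  have hexp : Real.exp (-(2 * γ) * |x|) ≤ Real.exp (-γ * |x|) := by
    rw [Real.exp_le_exp]
    nlinarith [abs_nonneg x]
  have hE := Real.exp_pos (-γ * |x|)
  simp only [hH]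
  rcases lt_abs.1 hx with h | h
  · refine (h1 x h).trans ?_
    nlinarith [mul_le_mul_of_nonneg_left hexp hC1.le, mul_pos hC2 hE]
  · have h3 := h2 (-x) h
    rw [abs_neg, neg_neg] at h3
    rw [← integral_neg_eq_self]
    have e : ∀ z, (1 - F (-min z (-x))) - (1 - F (-z)) * (1 - F x)
        = F (min (-z) x) - F (-z) * F x := by
      intro z
      rcases le_total z (-x) with h | h
      · rw [min_eq_left h, min_eq_right (by linarith)]; ring
      · rw [min_eq_right h, min_eq_left (by linarith), neg_neg]; ring
    simp only [e] at h3
    refine h3.trans ?_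
    nlinarith [mul_le_mul_of_nonneg_left hexp hC2.le, mul_pos hC1 hE]
end

section
/- There exists a constant C > 0 such that for all x with |x| > A one has ∫_ℝ ( ∫_0^z H(u,x) du )² f(z) dz ≤ C·exp(−γ|x|), where the inner integral ∫_0^z is the signed integral from 0 to z. -/
open MeasureTheory

theorem drift_aux (S : ℝ → ℝ) (hS : Continuous S) (A γ : ℝ) (hA : 0 < A)
    (hSr : ∀ x, A < x → S x ≤ -γ) :
    ∃ k : ℝ, ∀ y z : ℝ, 0 ≤ y → y ≤ z →
      2 * (∫ u in (0:ℝ)..z, S u) + 2 * γ * z ≤ 2 * (∫ u in (0:ℝ)..y, S u) + 2 * γ * y + k := by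
  set b : ℝ → ℝ := fun x => 2 * (∫ u in (0:ℝ)..x, S u) + 2 * γ * x with hb
  have hd : ∀ x, HasDerivAt b (2 * S x + 2 * γ) x := by
    intro x
    have h1 := (hS.integral_hasStrictDerivAt 0 x).hasDerivAt.const_mul 2
    have h2 := (hasDerivAt_id x).const_mul (2 * γ)
    have h3 := h1.add h2
    rw [mul_one] at h3
    exact h3
  have hc : Continuous b := continuous_iff_continuousAt.2 fun x => (hd x).continuousAt
  have hanti : AntitoneOn b (Set.Ici A) := by
    apply antitoneOn_of_deriv_nonpos (convex_Ici A) hc.continuousOn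
    · intro x _
      exact (hd x).differentiableAt.differentiableWithinAt
    · intro x hx
      rw [interior_Ici] at hx
      rw [(hd x).deriv]
      have := hSr x hx
      linarith
  obtain ⟨C, hC⟩ := isCompact_Icc.exists_bound_of_continuousOn (s := Set.Icc 0 A) hc.continuousOn
  have hC' : ∀ x, 0 ≤ x → x ≤ A → -C ≤ b x ∧ b x ≤ C := fun x h0 h1 => abs_le.1 (hC x ⟨h0, h1⟩)
  have hA0 := hC' A hA.le le_rfl
  refine ⟨2 * C, fun y z hy hyz => ?_⟩
  change b z ≤ b y + 2 * C
  rcases le_total z A with h | h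
  · have := hC' y hy (hyz.trans h)
    have := hC' z (hy.trans hyz) h
    linarith
  · rcases le_total y A with h' | h'
    · have := hC' y hy h'
      have := hanti Set.self_mem_Ici h h
      linarith
    · have := hanti h' h hyz
      linarith

theorem integrable_exp_abs_aux (a : ℝ) (ha : 0 < a) :
    Integrable (fun z : ℝ => Real.exp (-(a * |z|))) := by
  rw [← integrableOn_univ, ← Set.Iic_union_Ioi (a := (0:ℝ))]
  apply IntegrableOn.union
  · refine (integrableOn_exp_mul_Iic ha 0).congr_fun ?_ measurableSet_Iic
    intro x hx
    simp only [Set.mem_Iic] at hx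
    simp [abs_of_nonpos hx]
  · refine (integrableOn_exp_mul_Ioi (neg_lt_zero.2 ha) 0).congr_fun ?_ measurableSet_Ioi
    intro x hx
    simp only [Set.mem_Ioi] at hx
    simp [abs_of_pos hx]

theorem decay_aux (g : ℝ → ℝ) (γ K : ℝ)
    (h1 : ∀ y z, 0 ≤ y → y ≤ z → g z ≤ K * g y * Real.exp (-(2 * γ * (z - y))))
    (h2 : ∀ y z, y ≤ 0 → z ≤ y → g z ≤ K * g y * Real.exp (-(2 * γ * (y - z)))) (z : ℝ) :
    g z ≤ K * g 0 * Real.exp (-(2 * γ * |z|)) := by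
  rcases le_total 0 z with h | h
  · simpa [abs_of_nonneg h] using h1 0 z le_rfl h
  · simpa [abs_of_nonpos h] using h2 0 z le_rfl h

theorem tailR_aux (f : ℝ → ℝ) (γ K : ℝ) (hγ : 0 < γ) (hi : Integrable f)
    (h1 : ∀ y z, 0 ≤ y → y ≤ z → f z ≤ K * f y * Real.exp (-(2 * γ * (z - y))))
    (x : ℝ) (hx : 0 ≤ x) : ∫ y in Set.Ioi x, f y ≤ K / (2 * γ) * f x := by
  have hneg : -(2 * γ) < 0 := by linarith
  calc ∫ y in Set.Ioi x, f y
      ≤ ∫ y in Set.Ioi x, K * f x * Real.exp (2 * γ * x) * Real.exp (-(2 * γ) * y) := by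
        apply setIntegral_mono_on hi.integrableOn
          ((integrableOn_exp_mul_Ioi hneg x).const_mul _) measurableSet_Ioi
        intro y hy
        refine (h1 x y hx (le_of_lt hy)).trans (le_of_eq ?_)
        rw [mul_assoc (K * f x), ← Real.exp_add]
        ring_nf
    _ = K / (2 * γ) * f x := by
        rw [integral_const_mul, integral_exp_mul_Ioi hneg, neg_mul, Real.exp_neg]
        have := Real.exp_ne_zero (2 * γ * x)
        field_simp

theorem tailL_aux (f : ℝ → ℝ) (γ K : ℝ) (hγ : 0 < γ) (hi : Integrable f)
    (h2 : ∀ y z, y ≤ 0 → z ≤ y → f z ≤ K * f y * Real.exp (-(2 * γ * (y - z))))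
    (x : ℝ) (hx : x ≤ 0) : ∫ y in Set.Iic x, f y ≤ K / (2 * γ) * f x := by
  have hpos : 0 < 2 * γ := by linarith
  calc ∫ y in Set.Iic x, f y
      ≤ ∫ y in Set.Iic x, K * f x * Real.exp (-(2 * γ * x)) * Real.exp ((2 * γ) * y) := by
        apply setIntegral_mono_on hi.integrableOn
          ((integrableOn_exp_mul_Iic hpos x).const_mul _) measurableSet_Iic
        intro y hy
        refine (h2 x y hx hy).trans (le_of_eq ?_)
        rw [mul_assoc (K * f x), ← Real.exp_add]
        ring_nf
    _ = K / (2 * γ) * f x := by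
        rw [integral_const_mul, integral_exp_mul_Iic hpos, Real.exp_neg]
        have := Real.exp_ne_zero (2 * γ * x)
        field_simp

/-- pure inequality: `2 * p * q / w` for the kernel in the region where `x ≥ 0`.
`p = F u`, `T = 1 - F`. -/
theorem H_bound_aux (f F T : ℝ → ℝ) (γ K c : ℝ) (hγ : 0 < γ) (hK : 0 < K) (hc : 0 < c)
    (hf : ∀ x, 0 < f x)
    (h1 : ∀ y z, 0 ≤ y → y ≤ z → f z ≤ K * f y * Real.exp (-(2 * γ * (z - y))))
    (hF0 : ∀ x, 0 ≤ F x) (hT0 : ∀ x, 0 ≤ T x) (hF1 : ∀ x, F x ≤ 1)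
    (hFc : ∀ x, x ≤ 0 → F x ≤ c * f x) (hTc : ∀ x, 0 ≤ x → T x ≤ c * f x)
    (x : ℝ) (hx : 0 ≤ x) (u : ℝ) :
    (u ≤ x → 2 * (F u * T x) / f u ≤
      (2 * c + 2 * c * K + 2 * c * c * K * f 0) * Real.exp (-(γ * (x - |u|) / 2))) ∧
    (x ≤ u → 2 * (F x * T u) / f u ≤
      (2 * c + 2 * c * K + 2 * c * c * K * f 0) * Real.exp (-(γ * (x - |u|) / 2))) := by
  have hf0 := hf 0
  have hfu := hf u
  have hfx := hf x
  have a1 : 0 < 2 * c := by positivity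
  have a2 : 0 < 2 * c * K := by positivity
  have a3 : 0 < 2 * c * c * K * f 0 := by positivity
  constructor
  · intro hux
    rw [div_le_iff₀ hfu]
    rcases le_total u 0 with hu | hu
    · have e : Real.exp (-(2 * γ * (x - 0))) ≤ Real.exp (-(γ * (x - |u|) / 2)) := by
        apply Real.exp_le_exp.2
        have := abs_nonneg u
        nlinarith [mul_nonneg hγ.le this, mul_nonneg hγ.le hx]
      have hT : T x ≤ c * (K * f 0 * Real.exp (-(γ * (x - |u|) / 2))) :=
        (hTc x hx).trans (mul_le_mul_of_nonneg_left
          ((h1 0 x le_rfl hx).trans (mul_le_mul_of_nonneg_left e (by positivity))) hc.le)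
      have hp := Real.exp_pos (-(γ * (x - |u|) / 2))
      generalize Real.exp (-(γ * (x - |u|) / 2)) = E at *
      have := mul_le_mul (hFc u hu) hT (hT0 x) (by positivity)
      have q1 : 0 < (2 * c + 2 * c * K) * E * f u := by positivity
      nlinarith
    · have e : Real.exp (-(2 * γ * (x - u))) ≤ Real.exp (-(γ * (x - |u|) / 2)) := by
        apply Real.exp_le_exp.2
        rw [abs_of_nonneg hu]
        nlinarith [mul_nonneg hγ.le (sub_nonneg.2 hux)]
      have hT : T x ≤ c * (K * f u * Real.exp (-(γ * (x - |u|) / 2))) :=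
        (hTc x hx).trans (mul_le_mul_of_nonneg_left
          ((h1 u x hu hux).trans (mul_le_mul_of_nonneg_left e (by positivity))) hc.le)
      have hp := Real.exp_pos (-(γ * (x - |u|) / 2))
      generalize Real.exp (-(γ * (x - |u|) / 2)) = E at *
      have := mul_le_mul (hF1 u) hT (hT0 x) (by positivity)
      have q1 : 0 < (2 * c + 2 * c * c * K * f 0) * E * f u := by positivity
      nlinarith
  · intro hxu
    rw [div_le_iff₀ hfu]
    have hu := hx.trans hxu
    have e : 1 ≤ Real.exp (-(γ * (x - |u|) / 2)) := by
      apply Real.one_le_exp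
      rw [abs_of_nonneg hu]
      nlinarith [mul_nonneg hγ.le (sub_nonneg.2 hxu)]
    generalize Real.exp (-(γ * (x - |u|) / 2)) = E at *
    have := mul_le_mul (hF1 x) (hTc u hu) (hT0 u) (by positivity)
    have q1 : 0 < (2 * c * K + 2 * c * c * K * f 0) * E * f u := by positivity
    have q2 : 2 * c * f u * 1 ≤ 2 * c * f u * E := mul_le_mul_of_nonneg_left e (by positivity)
    nlinarith

theorem core_aux (f : ℝ → ℝ) (γ K : ℝ) (hγ : 0 < γ) (hK : 0 < K) (hi : Integrable f)
    (hf : ∀ x, 0 < f x) (hone : ∫ y, f y = 1)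
    (h1 : ∀ y z, 0 ≤ y → y ≤ z → f z ≤ K * f y * Real.exp (-(2 * γ * (z - y))))
    (h2 : ∀ y z, y ≤ 0 → z ≤ y → f z ≤ K * f y * Real.exp (-(2 * γ * (y - z))))
    (F : ℝ → ℝ) (hF : ∀ x, F x = ∫ y in Set.Iic x, f y)
    (H : ℝ → ℝ → ℝ) (hH : ∀ z x, H z x = 2 * (F (min z x) - F z * F x) / f z) :
    ∃ C > (0:ℝ), ∀ x : ℝ,
      (∫ z : ℝ, (∫ u in (0:ℝ)..z, H u x) ^ 2 * f z) ≤ C * Real.exp (-γ * |x|) := by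
  obtain ⟨c, hc⟩ : ∃ c, c = K / (2 * γ) := ⟨_, rfl⟩
  have hcpos : 0 < c := by rw [hc]; positivity
  have hT : ∀ x, 1 - F x = ∫ y in Set.Ioi x, f y := by
    intro x
    have := integral_add_compl (measurableSet_Iic (a := x)) hi
    rw [Set.compl_Iic, ← hF, hone] at this
    linarith
  have hF0 : ∀ x, 0 ≤ F x := fun x => by
    rw [hF]; exact integral_nonneg fun y => (hf y).le
  have hT0 : ∀ x, 0 ≤ 1 - F x := fun x => by
    rw [hT]; exact integral_nonneg fun y => (hf y).le
  have hFc : ∀ x, x ≤ 0 → F x ≤ c * f x := fun x hx => by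
    rw [hF, hc]; exact tailL_aux f γ K hγ hi h2 x hx
  have hTc : ∀ x, 0 ≤ x → 1 - F x ≤ c * f x := fun x hx => by
    rw [hT, hc]; exact tailR_aux f γ K hγ hi h1 x hx
  obtain ⟨L, hL⟩ : ∃ L, L = 2 * c + 2 * c * K + 2 * c * c * K * f 0 := ⟨_, rfl⟩
  have hf0 := hf 0
  have hLpos : 0 < L := by rw [hL]; positivity
  have hHb : ∀ u x, |H u x| ≤ L * Real.exp (-(γ * (|x| - |u|) / 2)) := by
    intro u x
    have hle : u ≤ x → H u x = 2 * (F u * (1 - F x)) / f u := fun h => by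
      rw [hH, min_eq_left h]; ring
    have hge : x ≤ u → H u x = 2 * (F x * (1 - F u)) / f u := fun h => by
      rw [hH, min_eq_right h]; ring
    have hnn : 0 ≤ H u x := by
      have := hf u
      have := hF0 u
      have := hF0 x
      have := hT0 u
      have := hT0 x
      rcases le_total u x with h | h
      · rw [hle h]; positivity
      · rw [hge h]; positivity
    rw [abs_of_nonneg hnn]
    rcases le_total 0 x with hx | hx
    · have := H_bound_aux f F (fun x => 1 - F x) γ K c hγ hK hcpos hf h1 hF0 hT0
        (fun x => by linarith [hT0 x]) hFc hTc x hx u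
      rw [← hL] at this
      rw [abs_of_nonneg hx]
      rcases le_total u x with h | h
      · rw [hle h]; exact this.1 h
      · rw [hge h]; exact this.2 h
    · have := H_bound_aux (fun x => f (-x)) (fun x => 1 - F (-x)) (fun x => F (-x)) γ K c hγ hK
        hcpos (fun x => hf _)
        (fun y z hy hz => by
          have := h2 (-y) (-z) (by linarith) (by linarith)
          rwa [show -y - -z = z - y by ring] at this)
        (fun x => hT0 _) (fun x => hF0 _)
        (fun x => by linarith [hF0 (-x)]) (fun x hx => hTc _ (by linarith))
        (fun x hx => hFc _ (by linarith)) (-x) (by linarith) (-u)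
      simp only [neg_neg, neg_zero, abs_neg] at this
      rw [← hL] at this
      rw [abs_of_nonpos hx]
      rcases le_total u x with h | h
      · rw [hle h, mul_comm (F u)]; exact this.2 (by linarith)
      · rw [hge h, mul_comm (F x)]; exact this.1 (by linarith)
  have hgi : Integrable (fun z : ℝ => Real.exp (-(γ / 2 * |z|))) :=
    integrable_exp_abs_aux (γ / 2) (by linarith)
  obtain ⟨D, hD⟩ : ∃ D, D = L ^ 2 * (16 / γ ^ 2) * (K * f 0) := ⟨_, rfl⟩
  have hDpos : 0 < D := by rw [hD]; positivity
  have hI0 : 0 ≤ ∫ z : ℝ, Real.exp (-(γ / 2 * |z|)) :=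
    integral_nonneg fun z => (Real.exp_pos _).le
  refine ⟨D * (∫ z : ℝ, Real.exp (-(γ / 2 * |z|))) + 1, by positivity, fun x => ?_⟩
  have key : ∀ z, (∫ u in (0:ℝ)..z, H u x) ^ 2 * f z ≤
      D * Real.exp (-γ * |x|) * Real.exp (-(γ / 2 * |z|)) := by
    intro z
    have hJ : |∫ u in (0:ℝ)..z, H u x| ≤ L * Real.exp (-(γ * (|x| - |z|) / 2)) * |z| := by
      have := intervalIntegral.norm_integral_le_of_norm_le_const (a := 0) (b := z)
        (f := fun u => H u x) (C := L * Real.exp (-(γ * (|x| - |z|) / 2))) (by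
          intro u hu
          refine (hHb u x).trans ?_
          have huz : |u| ≤ |z| := by
            rcases Set.mem_uIoc.1 hu with ⟨h, h'⟩ | ⟨h, h'⟩
            · rw [abs_of_pos h, abs_of_pos (h.trans_le h')]; exact h'
            · rw [abs_of_nonpos h', abs_of_neg (h.trans_le h')]; linarith
          gcongr)
      simpa using this
    have hsq : (∫ u in (0:ℝ)..z, H u x) ^ 2 ≤
        L ^ 2 * Real.exp (-(γ * (|x| - |z|))) * |z| ^ 2 := by
      rw [← sq_abs]
      refine (pow_le_pow_left₀ (abs_nonneg _) hJ 2).trans (le_of_eq ?_)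
      rw [mul_pow, mul_pow, ← Real.exp_nat_mul]
      congr 3
      push_cast; ring
    have hz2 : |z| ^ 2 ≤ 16 / γ ^ 2 * Real.exp (γ / 2 * |z|) := by
      have e1 : γ / 4 * |z| ≤ Real.exp (γ / 4 * |z|) := by
        linarith [Real.add_one_le_exp (γ / 4 * |z|)]
      have e2 := pow_le_pow_left₀ (by positivity) e1 2
      rw [← Real.exp_nat_mul, show ((2:ℕ):ℝ) * (γ / 4 * |z|) = γ / 2 * |z| by push_cast; ring] at e2
      rw [div_mul_eq_mul_div, le_div_iff₀ (by positivity)]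
      nlinarith
    calc (∫ u in (0:ℝ)..z, H u x) ^ 2 * f z
        ≤ (L ^ 2 * Real.exp (-(γ * (|x| - |z|))) * (16 / γ ^ 2 * Real.exp (γ / 2 * |z|))) *
          (K * f 0 * Real.exp (-(2 * γ * |z|))) := by
          apply mul_le_mul _ (decay_aux f γ K h1 h2 z) (hf z).le (by positivity)
          exact hsq.trans (mul_le_mul_of_nonneg_left hz2 (by positivity))
      _ = D * (Real.exp (-(γ * (|x| - |z|))) * Real.exp (γ / 2 * |z|) *
            Real.exp (-(2 * γ * |z|))) := by rw [hD]; ring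
      _ = D * Real.exp (-γ * |x|) * Real.exp (-(γ / 2 * |z|)) := by
          rw [mul_assoc D, ← Real.exp_add, ← Real.exp_add, ← Real.exp_add]
          congr 2; ring
  calc (∫ z : ℝ, (∫ u in (0:ℝ)..z, H u x) ^ 2 * f z)
      ≤ ∫ z : ℝ, D * Real.exp (-γ * |x|) * Real.exp (-(γ / 2 * |z|)) := by
        apply integral_mono_of_nonneg (Filter.Eventually.of_forall fun z => ?_)
          (hgi.const_mul _) (Filter.Eventually.of_forall key)
        exact mul_nonneg (sq_nonneg _) (hf z).le
    _ = (D * ∫ z : ℝ, Real.exp (-(γ / 2 * |z|))) * Real.exp (-γ * |x|) := by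
        rw [integral_const_mul]; ring
    _ ≤ _ := by
        apply mul_le_mul_of_nonneg_right _ (Real.exp_pos _).le
        linarith

/-- There is `C > 0` such that for `|x| > A`,
`∫ ( ∫_0^z H(u,x) du )² f(z) dz ≤ C·exp(−γ|x|)`, where the inner integral is
the signed integral from 0 to z. -/
theorem stmt_17
    (S : ℝ → ℝ) (hS : Continuous S)
    (A γ : ℝ) (hA : 0 < A) (hγ : 0 < γ)
    (hSr : ∀ x, A < x → S x ≤ -γ)
    (hSl : ∀ x, x < -A → γ ≤ S x)
    (B : ℝ → ℝ) (hB : ∀ x, B x = 2 * ∫ y in (0:ℝ)..x, S y)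
    (G : ℝ) (hG : G = ∫ y : ℝ, Real.exp (B y))
    (f : ℝ → ℝ) (hf : ∀ x, f x = Real.exp (B x) / G)
    (F : ℝ → ℝ) (hF : ∀ x, F x = ∫ y in Set.Iic x, f y)
    (H : ℝ → ℝ → ℝ)
    (hH : ∀ z x, H z x = 2 * (F (min z x) - F z * F x) / f z) :
    ∃ C > (0:ℝ), ∀ x : ℝ, A < |x| →
      (∫ z : ℝ, (∫ u in (0:ℝ)..z, H u x) ^ 2 * f z) ≤
        C * Real.exp (-γ * |x|) := by
  obtain ⟨k1, hk1⟩ := drift_aux S hS A γ hA hSr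
  obtain ⟨k2, hk2⟩ := drift_aux (fun u => -S (-u)) (by fun_prop) A γ hA
    (fun x hx => by linarith [hSl (-x) (by linarith)])
  have hrefl : ∀ z : ℝ, ∫ u in (0:ℝ)..z, -S (-u) = ∫ u in (0:ℝ)..(-z), S u := by
    intro z
    rw [intervalIntegral.integral_neg, intervalIntegral.integral_comp_neg (fun u => S u),
      intervalIntegral.integral_symm, neg_zero, neg_neg]
  simp only [hrefl, ← hB] at hk1 hk2
  obtain ⟨K, hK⟩ : ∃ K, K = Real.exp (max k1 k2) := ⟨_, rfl⟩
  have hKpos : 0 < K := by rw [hK]; exact Real.exp_pos _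
  have h1 : ∀ y z, 0 ≤ y → y ≤ z →
      Real.exp (B z) ≤ K * Real.exp (B y) * Real.exp (-(2 * γ * (z - y))) := by
    intro y z hy hyz
    rw [hK, ← Real.exp_add, ← Real.exp_add]
    apply Real.exp_le_exp.2
    linarith [hk1 y z hy hyz, le_max_left k1 k2]
  have h2 : ∀ y z, y ≤ 0 → z ≤ y →
      Real.exp (B z) ≤ K * Real.exp (B y) * Real.exp (-(2 * γ * (y - z))) := by
    intro y z hy hyz
    rw [hK, ← Real.exp_add, ← Real.exp_add]
    apply Real.exp_le_exp.2
    have := hk2 (-y) (-z) (by linarith) (by linarith)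
    simp only [neg_neg] at this
    linarith [le_max_right k1 k2]
  have hBc : Continuous B := by
    have : B = fun x => 2 * ∫ y in (0:ℝ)..x, S y := funext hB
    rw [this]
    exact continuous_const.mul (intervalIntegral.continuous_primitive
      (fun a b => hS.intervalIntegrable a b) 0)
  have hEi : Integrable (fun y => Real.exp (B y)) := by
    refine ((integrable_exp_abs_aux (2 * γ) (by linarith)).const_mul
      (K * Real.exp (B 0))).mono' (Real.continuous_exp.comp hBc).aestronglyMeasurable ?_
    refine Filter.Eventually.of_forall fun z => ?_
    rw [Real.norm_eq_abs, abs_of_pos (Real.exp_pos _)]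
    exact decay_aux (fun y => Real.exp (B y)) γ K h1 h2 z
  have hGpos : 0 < G := by
    rw [hG]; exact integral_exp_pos hEi
  have hf' : f = fun x => Real.exp (B x) / G := funext hf
  obtain ⟨C, hC, h⟩ := core_aux f γ K hγ hKpos (by rw [hf']; exact hEi.div_const G)
    (fun x => by rw [hf]; positivity)
    (by rw [hf', integral_div, ← hG]; exact div_self hGpos.ne')
    (fun y z hy hz => by
      rw [hf, hf, div_le_iff₀ hGpos]
      refine (h1 y z hy hz).trans (le_of_eq ?_)
      field_simp)
    (fun y z hy hz => by
      rw [hf, hf, div_le_iff₀ hGpos]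
      refine (h2 y z hy hz).trans (le_of_eq ?_)
      field_simp) F hF H hH
  exact ⟨C, hC, fun x _ => h x⟩
end
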